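/- arXiv:2109.00801 — 5 statements merged into one kernel-verified Lean document; each statement's English description precedes it below -/
import Mathlib

section
/- Let A be a commutative ring and f ∈ A such that the pair (A,(f)) is of reduced prismatic type. Let N be an A-module which is f-adically complete and such that N/f^nN is a flat A/f^nA-module for every integer n ≥ 1. Then N is (f)-completely flat, i.e. Tor_i^A(N, A/fA) = 0 for all i ≥ 1, and N is derived f-complete. If in addition each N/f^nN is faithfully flat over A/f^nA, then moreover N/fN is faithfully flat over A/fA. -/
open TensorProduct CategoryTheory

universe u

section Defs
variable (A : Type u) [CommRing A]

/-- `M` is derived `f`-complete: `Hom_A(A_f, M) = 0` and `Ext¹_A(A_f, M) = 0`,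
where `A_f = A[1/f]`. -/
noncomputable def DerivedComplete (f : A) (M : Type u) [AddCommGroup M] [Module A M] : Prop :=
  (∀ g : Localization.Away f →ₗ[A] M, g = 0) ∧
  Subsingleton (((Ext A (ModuleCat.{u} A) 1).obj
      (Opposite.op (ModuleCat.of A (Localization.Away f)))).obj (ModuleCat.of A M))

/-- `Tor_i^A(M, N) = 0` for all `i ≥ 1`. -/
noncomputable def TorVanish (M N : Type u) [AddCommGroup M] [Module A M]
    [AddCommGroup N] [Module A N] : Prop :=
  ∀ i : ℕ, 1 ≤ i →
    Subsingleton (((Tor (ModuleCat.{u} A) i).obj (ModuleCat.of A M)).obj (ModuleCat.of A N))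

end Defs

section TorIndependence

variable {A : Type u} [CommRing A]

/-- If `N / I N` is flat over `A / I`, then `N ⊗ -` preserves injectivity of maps between
`A`-modules killed by `I`. -/
theorem lTensor_injective_of_flat_quotient (I : Ideal A) (N : Type u) [AddCommGroup N] [Module A N]
    [Module.Flat (A ⧸ I) ((A ⧸ I) ⊗[A] N)] {M M' : Type u} [AddCommGroup M] [Module A M]
    [AddCommGroup M'] [Module A M'] (hM : ∀ a ∈ I, ∀ m : M, a • m = 0)
    (hM' : ∀ a ∈ I, ∀ m : M', a • m = 0) (j : M →ₗ[A] M') (hj : Function.Injective j) :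
    Function.Injective (j.lTensor N) := by
  let _ : Module (A ⧸ I) M :=
    Module.IsTorsionBySet.module (I := I) (fun m a ↦ hM a a.2 m)
  let _ : Module (A ⧸ I) M' :=
    Module.IsTorsionBySet.module (I := I) (fun m a ↦ hM' a a.2 m)
  have : IsScalarTower A (A ⧸ I) M := Module.IsTorsionBySet.isScalarTower (S := A) _
  have : IsScalarTower A (A ⧸ I) M' := Module.IsTorsionBySet.isScalarTower (S := A) _
  let g : M →ₗ[A ⧸ I] M' := j.extendScalarsOfSurjective Ideal.Quotient.mk_surjective
  have hg : Function.Injective (g.rTensor ((A ⧸ I) ⊗[A] N)) :=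
    Module.Flat.rTensor_preserves_injective_linearMap g hj
  let e := (AlgebraTensorModule.cancelBaseChange A (A ⧸ I) (A ⧸ I) M N).restrictScalars A
  let e' := (AlgebraTensorModule.cancelBaseChange A (A ⧸ I) (A ⧸ I) M' N).restrictScalars A
  have key : j.rTensor N ∘ₗ e.toLinearMap =
      e'.toLinearMap ∘ₗ (g.rTensor ((A ⧸ I) ⊗[A] N)).restrictScalars A := by
    refine LinearMap.ext fun z ↦ ?_
    induction z with
    | zero => simp only [map_zero]
    | add a b ha hb => simp only [map_add, ha, hb]
    | tmul m z =>
      induction z with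
      | zero => simp only [TensorProduct.tmul_zero, map_zero]
      | add a b ha hb => simp only [TensorProduct.tmul_add, map_add, ha, hb]
      | tmul b n =>
        change j.rTensor N (AlgebraTensorModule.cancelBaseChange A (A ⧸ I) (A ⧸ I) M N
            (m ⊗ₜ (b ⊗ₜ n))) = AlgebraTensorModule.cancelBaseChange A (A ⧸ I) (A ⧸ I) M' N
            (g m ⊗ₜ (b ⊗ₜ n))
        rw [AlgebraTensorModule.cancelBaseChange_tmul, AlgebraTensorModule.cancelBaseChange_tmul,
          LinearMap.rTensor_tmul, ← map_smul]
        rfl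
  rw [LinearMap.lTensor_inj_iff_rTensor_inj]
  have : Function.Injective (j.rTensor N ∘ₗ e.toLinearMap) := by
    rw [key]
    exact e'.injective.comp hg
  intro x y hxy
  obtain ⟨x, rfl⟩ := e.surjective x
  obtain ⟨y, rfl⟩ := e.surjective y
  exact congrArg e (this hxy)

theorem Ideal.smul_quotient_eq_zero {I : Ideal A} {a : A} (ha : a ∈ I) (q : A ⧸ I) :
    a • q = 0 := by
  obtain ⟨b, rfl⟩ := Ideal.Quotient.mk_surjective q
  rw [Algebra.smul_def, Ideal.Quotient.algebraMap_eq, Ideal.Quotient.eq_zero_iff_mem.2 ha, zero_mul]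

/-- `Tor` vanishing of `N` against modules killed by `f`, together with the corresponding
description of the `f`-torsion of `N`. -/
structure IsTorIndependent (f : A) (N : Type u) [AddCommGroup N] [Module A N] : Prop where
  lTensor_injective : ∀ {M M' : Type u} [AddCommGroup M] [Module A M] [AddCommGroup M']
    [Module A M'] (j : M →ₗ[A] M'), (∀ m : M, f • m = 0) → (∀ m : M', f • m = 0) →
    Function.Injective j → Function.Injective (j.lTensor N)
  torsion_injective : Function.Injective ((Submodule.torsionBy A A f).subtype.lTensor N)
  tmul_one_mem_range : ∀ x : N, f • x = 0 →
    x ⊗ₜ[A] (1 : A) ∈ LinearMap.range ((Submodule.torsionBy A A f).subtype.lTensor N)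

theorem exists_flat_presentation (N : Type u) [AddCommGroup N] [Module A N] :
    ∃ (K : Type u) (_ : AddCommGroup K) (_ : Module A K) (F : Type u) (_ : AddCommGroup F)
      (_ : Module A F) (_ : Module.Flat A F) (i : K →ₗ[A] F) (π : F →ₗ[A] N),
      Function.Injective i ∧ Function.Exact i π ∧ Function.Surjective π := by
  let π : (N →₀ A) →ₗ[A] N := Finsupp.linearCombination A id
  exact ⟨LinearMap.ker π, inferInstance, inferInstance, N →₀ A, inferInstance, inferInstance,
    inferInstance, (LinearMap.ker π).subtype, π, Submodule.subtype_injective _,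
    LinearMap.exact_subtype_ker_map π, Finsupp.linearCombination_id_surjective A N⟩

section Diagram

variable {K F N : Type u} [AddCommGroup K] [Module A K] [AddCommGroup F] [Module A F]
  [AddCommGroup N] [Module A N] {i : K →ₗ[A] F} {π : F →ₗ[A] N}

/-- If `0 → K → F → N → 0` and `0 → L → G → M → 0` are presentations such that `N ⊗ L → N ⊗ G`
and `K ⊗ G → F ⊗ G` are injective, then so is `K ⊗ M → F ⊗ M`. -/
theorem rTensor_injective_of_presentation {L G M : Type u} [AddCommGroup L] [Module A L]
    [AddCommGroup G] [Module A G] [AddCommGroup M] [Module A M] {ι : L →ₗ[A] G} {p : G →ₗ[A] M}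
    (hex : Function.Exact i π) (hπ : Function.Surjective π)
    (hex' : Function.Exact ι p) (hp : Function.Surjective p)
    (hN : Function.Injective (ι.lTensor N)) (hG : Function.Injective (i.rTensor G)) :
    Function.Injective (i.rTensor M) := by
  rw [injective_iff_map_eq_zero]
  intro z hz
  obtain ⟨z', rfl⟩ := LinearMap.lTensor_surjective K hp z
  have h1 : p.lTensor F (i.rTensor G z') = 0 := by
    rw [← hz, ← LinearMap.comp_apply, ← LinearMap.comp_apply, LinearMap.lTensor_comp_rTensor,
      LinearMap.rTensor_comp_lTensor]
  obtain ⟨y, hy⟩ := (lTensor_exact F hex' hp _).1 h1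
  have h2 : π.rTensor L y = 0 := by
    apply hN
    rw [map_zero, ← LinearMap.comp_apply, LinearMap.lTensor_comp_rTensor,
      ← LinearMap.rTensor_comp_lTensor, LinearMap.comp_apply, hy]
    exact (rTensor_exact G hex hπ _).2 ⟨z', rfl⟩
  obtain ⟨w, rfl⟩ := (rTensor_exact L hex hπ _).1 h2
  have h3 : z' = ι.lTensor K w := by
    apply hG
    rw [← hy, ← LinearMap.comp_apply, ← LinearMap.comp_apply, LinearMap.lTensor_comp_rTensor,
      LinearMap.rTensor_comp_lTensor]
  rw [h3]
  exact (lTensor_exact K hex' hp _).2 ⟨w, rfl⟩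

/-- Dimension shifting: exactness of `K ⊗ P₁ → K ⊗ P₀ → K ⊗ Q` for the syzygy `K` of `N` gives
exactness of `N ⊗ P₂ → N ⊗ P₁ → N ⊗ P₀`. -/
theorem lTensor_exact_of_syzygy [Module.Flat A F] {P₂ P₁ P₀ Q : Type u}
    [AddCommGroup P₂] [Module A P₂] [AddCommGroup P₁] [Module A P₁] [AddCommGroup P₀] [Module A P₀]
    [AddCommGroup Q] [Module A Q] {d₂ : P₂ →ₗ[A] P₁} {d₁ : P₁ →ₗ[A] P₀} {d₀ : P₀ →ₗ[A] Q}
    (hex : Function.Exact i π) (hπ : Function.Surjective π)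
    (hd : Function.Exact d₂ d₁) (hd' : d₀ ∘ₗ d₁ = 0)
    (hK : Function.Exact (d₁.lTensor K) (d₀.lTensor K)) (hQ : Function.Injective (i.rTensor Q)) :
    Function.Exact (d₂.lTensor N) (d₁.lTensor N) := by
  intro z
  constructor
  · intro hz
    obtain ⟨z', rfl⟩ := LinearMap.rTensor_surjective P₁ hπ z
    have h1 : π.rTensor P₀ (d₁.lTensor F z') = 0 := by
      rw [← hz, ← LinearMap.comp_apply, ← LinearMap.comp_apply, LinearMap.lTensor_comp_rTensor,
        LinearMap.rTensor_comp_lTensor]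
    obtain ⟨w, hw⟩ := (rTensor_exact P₀ hex hπ _).1 h1
    have h2 : d₀.lTensor K w = 0 := by
      apply hQ
      rw [map_zero, ← LinearMap.comp_apply, LinearMap.rTensor_comp_lTensor,
        ← LinearMap.lTensor_comp_rTensor, LinearMap.comp_apply, hw, ← LinearMap.comp_apply,
        ← LinearMap.lTensor_comp, hd']
      simp
    obtain ⟨w', rfl⟩ := (hK _).1 h2
    have h3 : d₁.lTensor F (z' - i.rTensor P₁ w') = 0 := by
      rw [map_sub, ← hw, sub_eq_zero, ← LinearMap.comp_apply, ← LinearMap.comp_apply,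
        LinearMap.lTensor_comp_rTensor, LinearMap.rTensor_comp_lTensor]
    obtain ⟨y, hy⟩ := (Module.Flat.lTensor_exact F hd _).1 h3
    refine ⟨π.rTensor P₂ y, ?_⟩
    have h4 : π.rTensor P₁ (i.rTensor P₁ w') = 0 := (rTensor_exact P₁ hex hπ _).2 ⟨w', rfl⟩
    rw [← LinearMap.comp_apply, LinearMap.lTensor_comp_rTensor,
        ← LinearMap.rTensor_comp_lTensor, LinearMap.comp_apply, hy, map_sub, h4, sub_zero]
  · rintro ⟨y, rfl⟩
    rw [← LinearMap.comp_apply, ← LinearMap.lTensor_comp, hd.linearMap_comp_eq_zero]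
    simp

end Diagram

namespace IsTorIndependent

variable {f : A} {K F N : Type u} [AddCommGroup K] [Module A K] [AddCommGroup F] [Module A F]
  [AddCommGroup N] [Module A N] {i : K →ₗ[A] F} {π : F →ₗ[A] N}

theorem rTensor_quotient_injective (h : IsTorIndependent f N) (hi : Function.Injective i)
    (hex : Function.Exact i π) (hπ : Function.Surjective π) :
    Function.Injective (i.rTensor (A ⧸ Ideal.span {f})) := by
  rw [injective_iff_map_eq_zero]
  intro z hz
  obtain ⟨k, rfl⟩ : ∃ k : K, z = k ⊗ₜ 1 := by
    obtain ⟨z', rfl⟩ := LinearMap.lTensor_surjective K (Ideal.span {f}).mkQ_surjective z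
    obtain ⟨k, rfl⟩ := (TensorProduct.rid A K).symm.surjective z'
    exact ⟨k, by simp⟩
  obtain ⟨y, hy⟩ : ∃ y : F, f • y = i k := by
    have := congrArg (TensorProduct.tensorQuotEquivQuotSMul F (Ideal.span {f})) hz
    rw [LinearMap.rTensor_tmul, map_zero, ← map_one (Ideal.Quotient.mk (Ideal.span {f})),
      TensorProduct.tensorQuotEquivQuotSMul_tmul_mk, one_smul, Submodule.Quotient.mk_eq_zero,
      Submodule.ideal_span_singleton_smul] at this
    obtain ⟨y, -, hy⟩ := this
    exact ⟨y, hy⟩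
  have hπy : f • π y = 0 := by
    rw [← map_smul, hy]; exact (hex _).2 ⟨k, rfl⟩
  obtain ⟨t, ht⟩ := h.tmul_one_mem_range _ hπy
  obtain ⟨t, rfl⟩ := LinearMap.rTensor_surjective _ hπ t
  set t' := TensorProduct.rid A F ((Submodule.torsionBy A A f).subtype.lTensor F t) with ht'
  have h1 : f • t' = 0 := by
    have : ∀ t : F ⊗[A] Submodule.torsionBy A A f, f • t = 0 := by
      intro t
      induction t with
      | zero => simp
      | add a b ha hb => rw [smul_add, ha, hb, add_zero]
      | tmul a b =>
        rw [← TensorProduct.tmul_smul, Submodule.smul_torsionBy, TensorProduct.tmul_zero]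
    rw [ht', ← map_smul, ← map_smul, this, map_zero, map_zero]
  have h2 : π t' = π y := by
    have hrid : ∀ z : F ⊗[A] A, π (TensorProduct.rid A F z) =
        TensorProduct.rid A N (π.rTensor A z) := by
      intro z
      induction z with
      | zero => simp
      | add a b ha hb => simp only [map_add, ha, hb]
      | tmul a b => simp
    rw [ht', hrid, ← LinearMap.comp_apply, LinearMap.rTensor_comp_lTensor,
      ← LinearMap.lTensor_comp_rTensor, LinearMap.comp_apply, ht]
    simp
  obtain ⟨k', hk'⟩ := (hex (y - t')).1 (by rw [map_sub, h2, sub_self])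
  have h3 : k = f • k' := hi (by rw [map_smul, hk', smul_sub, h1, sub_zero, hy])
  rw [h3, TensorProduct.smul_tmul,
    Ideal.smul_quotient_eq_zero (Ideal.mem_span_singleton_self f), TensorProduct.tmul_zero]

theorem rTensor_injective (h : IsTorIndependent f N) (hi : Function.Injective i)
    (hex : Function.Exact i π) (hπ : Function.Surjective π) (M : Type u) [AddCommGroup M]
    [Module A M] (hM : ∀ m : M, f • m = 0) : Function.Injective (i.rTensor M) := by
  let Q := A ⧸ Ideal.span {f}
  have hG : ∀ g : Q ⊗[A] (M →₀ A), f • g = 0 := by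
    intro g
    induction g with
    | zero => simp
    | add a b ha hb => rw [smul_add, ha, hb, add_zero]
    | tmul a b =>
      rw [TensorProduct.smul_tmul',
        Ideal.smul_quotient_eq_zero (Ideal.mem_span_singleton_self f), TensorProduct.zero_tmul]
  let _ : Module Q M :=
    Module.IsTorsionBySet.module (I := Ideal.span {f}) <| by
      rintro m ⟨a, ha⟩
      obtain ⟨b, rfl⟩ := Ideal.mem_span_singleton'.1 ha
      exact (mul_smul b f m).trans (by rw [hM, smul_zero])
  have : IsScalarTower A Q M := Module.IsTorsionBySet.isScalarTower (S := A) _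
  let p : Q ⊗[A] (M →₀ A) →ₗ[A] M :=
    (LinearMap.liftBaseChange Q (Finsupp.linearCombination A id)).restrictScalars A
  have hp : Function.Surjective p := fun m ↦ ⟨1 ⊗ₜ Finsupp.single m 1, by simp [p]⟩
  refine rTensor_injective_of_presentation hex hπ (LinearMap.exact_subtype_ker_map p) hp
    (h.lTensor_injective _ (fun m ↦ Subtype.ext (hG m)) hG (Submodule.subtype_injective _)) ?_
  have h1 := h.rTensor_quotient_injective hi hex hπ
  have h2 : Function.Injective ((i.rTensor Q).rTensor (M →₀ A)) :=
    Module.Flat.rTensor_preserves_injective_linearMap _ h1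
  rw [LinearMap.rTensor_tensor]
  simpa using h2

/-- Tor-independence passes to the kernel of a surjection from a flat module. -/
theorem syzygy (h : IsTorIndependent f N) [Module.Flat A F] (hi : Function.Injective i)
    (hex : Function.Exact i π) (hπ : Function.Surjective π) : IsTorIndependent f K where
  lTensor_injective {M M'} _ _ _ _ j hM hM' hj := by
    have h1 := h.rTensor_injective hi hex hπ M hM
    have h2 : Function.Injective (j.lTensor F) :=
      Module.Flat.lTensor_preserves_injective_linearMap j hj
    have h3 : Function.Injective (i.rTensor M' ∘ₗ j.lTensor K) := by
      rw [LinearMap.rTensor_comp_lTensor, ← LinearMap.lTensor_comp_rTensor]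
      exact h2.comp h1
    exact Function.Injective.of_comp h3
  torsion_injective := by
    have h1 := h.rTensor_injective hi hex hπ (Submodule.torsionBy A A f)
      (fun m ↦ Submodule.smul_torsionBy f m)
    have h2 : Function.Injective ((Submodule.torsionBy A A f).subtype.lTensor F) :=
      Module.Flat.lTensor_preserves_injective_linearMap _ (Submodule.subtype_injective _)
    have h3 : Function.Injective
        (i.rTensor A ∘ₗ (Submodule.torsionBy A A f).subtype.lTensor K) := by
      rw [LinearMap.rTensor_comp_lTensor, ← LinearMap.lTensor_comp_rTensor]
      exact h2.comp h1
    exact Function.Injective.of_comp h3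
  tmul_one_mem_range k hk := by
    have h1 : (LinearMap.lsmul A A f).lTensor F (i k ⊗ₜ 1) = 0 := by
      rw [LinearMap.lTensor_tmul, LinearMap.lsmul_apply, ← TensorProduct.smul_tmul, ← map_smul, hk,
        map_zero, TensorProduct.zero_tmul]
    have hT : Function.Exact (Submodule.torsionBy A A f).subtype (LinearMap.lsmul A A f) :=
      LinearMap.exact_subtype_ker_map _
    obtain ⟨z, hz⟩ := (Module.Flat.lTensor_exact F hT _).1 h1
    have h2 : π.rTensor _ z = 0 := by
      apply h.torsion_injective
      rw [map_zero, ← LinearMap.comp_apply, LinearMap.lTensor_comp_rTensor,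
        ← LinearMap.rTensor_comp_lTensor, LinearMap.comp_apply, hz, LinearMap.rTensor_tmul,
        (hex _).2 ⟨k, rfl⟩, TensorProduct.zero_tmul]
    obtain ⟨w, rfl⟩ := (rTensor_exact _ hex hπ _).1 h2
    refine ⟨w, Module.Flat.rTensor_preserves_injective_linearMap (M := A) i hi ?_⟩
    rw [LinearMap.rTensor_tmul, ← hz, ← LinearMap.comp_apply, ← LinearMap.comp_apply,
      LinearMap.lTensor_comp_rTensor, LinearMap.rTensor_comp_lTensor]

theorem lTensor_exact_resolution {P : ℕ → Type u} [∀ n, AddCommGroup (P n)] [∀ n, Module A (P n)]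
    [∀ n, Module.Flat A (P n)] (d : ∀ n, P (n + 1) →ₗ[A] P n)
    (ε : P 0 →ₗ[A] A ⧸ Ideal.span {f}) (hd : ∀ n, Function.Exact (d (n + 1)) (d n))
    (hdε : Function.Exact (d 0) ε) (hε : Function.Surjective ε) (n : ℕ) (N : Type u)
    [AddCommGroup N] [Module A N] (h : IsTorIndependent f N) :
    Function.Exact ((d (n + 1)).lTensor N) ((d n).lTensor N) := by
  obtain ⟨K, _, _, F, _, _, _, i, π, hi, hex, hπ⟩ := exists_flat_presentation (A := A) N
  induction n generalizing N K F with
  | zero =>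
    exact lTensor_exact_of_syzygy hex hπ (hd 0) hdε.linearMap_comp_eq_zero
      (lTensor_exact _ hdε hε) (h.rTensor_quotient_injective hi hex hπ)
  | succ n ih =>
    obtain ⟨K', _, _, F', _, _, _, i', π', hi', hex', hπ'⟩ := exists_flat_presentation (A := A) K
    exact lTensor_exact_of_syzygy hex hπ (hd (n + 1)) (hd n).linearMap_comp_eq_zero
      (ih K (h.syzygy hi hex hπ) K' _ _ F' _ _ ‹_› i' π' hi' hex' hπ')
      (Module.Flat.rTensor_preserves_injective_linearMap _ hi)

theorem torVanish (h : IsTorIndependent f N) : TorVanish A N (A ⧸ Ideal.span {f}) := by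
  intro i hi
  obtain ⟨n, rfl⟩ : ∃ n, i = n + 1 := ⟨i - 1, by omega⟩
  let X := ModuleCat.of A (A ⧸ Ideal.span {f})
  let P := projectiveResolution X
  have hP : ∀ n, Module.Flat A (P.complex.X n) := fun n ↦ by
    have := (IsProjective.iff_projective (P.complex.X n)).2 (P.projective n)
    infer_instance
  have hd : ∀ n, Function.Exact (P.complex.d (n + 2) (n + 1)).hom (P.complex.d (n + 1) n).hom :=
    fun n ↦ (ShortComplex.ShortExact.moduleCat_exact_iff_function_exact _).1 (P.exact_succ n)
  have hε : Function.Exact (P.complex.d 1 0).hom (P.π.f 0).hom :=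
    (ShortComplex.ShortExact.moduleCat_exact_iff_function_exact _).1 P.exact₀
  have hs : Function.Surjective (P.π.f 0).hom := (ModuleCat.epi_iff_surjective _).1 inferInstance
  have key := lTensor_exact_resolution (P := fun n ↦ P.complex.X n)
    (fun n ↦ (P.complex.d (n + 1) n).hom) (P.π.f 0).hom hd hε hs n N h
  refine ModuleCat.subsingleton_of_isZero ?_
  refine Limits.IsZero.of_iso ?_ (P.isoLeftDerivedObj
    ((MonoidalCategory.tensoringLeft (ModuleCat A)).obj (ModuleCat.of A N)) (n + 1))
  change Limits.IsZero (HomologicalComplex.homology _ _)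
  rw [← HomologicalComplex.exactAt_iff_isZero_homology,
    HomologicalComplex.exactAt_iff' _ (n + 2) (n + 1) n (by simp) (by simp)]
  rw [ShortComplex.ShortExact.moduleCat_exact_iff_function_exact]
  exact key

end IsTorIndependent
end TorIndependence

section FlatQuotients

variable {A : Type u} [CommRing A] {f : A} {N : Type u} [AddCommGroup N] [Module A N]

theorem mem_span_singleton_pow_smul_top {n : ℕ} {x : N} :
    x ∈ (Ideal.span {f} ^ n • ⊤ : Submodule A N) ↔ ∃ y, f ^ n • y = x := by
  rw [Ideal.span_singleton_pow, Submodule.ideal_span_singleton_smul]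
  exact ⟨fun ⟨y, _, hy⟩ ↦ ⟨y, hy⟩, fun ⟨y, hy⟩ ↦ ⟨y, trivial, hy⟩⟩

theorem eq_zero_of_forall_pow_smul [IsHausdorff (Ideal.span {f}) N] {x : N}
    (h : ∀ n, ∃ y, f ^ n • y = x) : x = 0 :=
  IsHausdorff.haus inferInstance x fun n ↦
    SModEq.zero.2 (mem_span_singleton_pow_smul_top.2 (h n))

theorem lTensor_torsionBy_eq_zero {c n : ℕ} (hcn : c ≤ n) (hn : 1 ≤ n)
    (hbdd : ∀ x : A, (∃ n : ℕ, f ^ n * x = 0) → f ^ c * x = 0)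
    [Module.Flat (A ⧸ Ideal.span {f} ^ n) ((A ⧸ Ideal.span {f} ^ n) ⊗[A] N)]
    (z : N ⊗[A] Submodule.torsionBy A A f)
    (hz : (Ideal.span {f} ^ n).mkQ.lTensor N ((Submodule.torsionBy A A f).subtype.lTensor N z) = 0) :
    z = 0 := by
  have key : Function.Injective
      (((Ideal.span {f} ^ n).mkQ ∘ₗ (Submodule.torsionBy A A f).subtype).lTensor N) := by
    refine lTensor_injective_of_flat_quotient (Ideal.span {f} ^ n) N ?_
      (fun a ha m ↦ Ideal.smul_quotient_eq_zero ha m) _ ?_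
    · rintro a ha ⟨t, ht⟩
      rw [Ideal.span_singleton_pow] at ha
      obtain ⟨b, rfl⟩ := Ideal.mem_span_singleton'.1 ha
      have ht' : f * t = 0 := ht
      obtain ⟨m, rfl⟩ : ∃ m, n = m + 1 := ⟨n - 1, by omega⟩
      exact Subtype.ext (show b * f ^ (m + 1) * t = 0 by
        rw [pow_succ, mul_assoc, mul_assoc, ht', mul_zero, mul_zero])
    · rw [injective_iff_map_eq_zero]
      rintro ⟨t, ht⟩ h
      have ht' : f * t = 0 := ht
      have h' : t ∈ Ideal.span {f} ^ n := (Submodule.Quotient.mk_eq_zero _).1 h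
      rw [Ideal.span_singleton_pow] at h'
      obtain ⟨b, rfl⟩ := Ideal.mem_span_singleton'.1 h'
      have h1 : f ^ c * b = 0 := hbdd b ⟨n + 1, by rw [← ht']; ring⟩
      obtain ⟨m, rfl⟩ := Nat.exists_eq_add_of_le hcn
      exact Subtype.ext (show b * f ^ (c + m) = 0 by
        rw [pow_add, ← mul_assoc, mul_comm b, h1, zero_mul])
  apply key
  rw [map_zero, LinearMap.lTensor_comp, LinearMap.comp_apply, hz]

theorem exists_tmul_one_eq_add (n : ℕ)
    [Module.Flat (A ⧸ Ideal.span {f} ^ (n + 1)) ((A ⧸ Ideal.span {f} ^ (n + 1)) ⊗[A] N)]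
    (x : N) (hx : f • x = 0) :
    ∃ (z : N ⊗[A] Submodule.torsionBy A A f) (y : N), x ⊗ₜ[A] (1 : A) =
      (Submodule.torsionBy A A f).subtype.lTensor N z + (f ^ n • y) ⊗ₜ[A] (1 : A) := by
  set I := Ideal.span {f} ^ (n + 1)
  have hI : ∀ a, a ∈ I ↔ ∃ b, b * f ^ (n + 1) = a := fun a ↦ by
    rw [show I = _ from Ideal.span_singleton_pow f (n + 1), Ideal.mem_span_singleton']
  let J : Ideal A := Submodule.comap (LinearMap.lsmul A A f) I
  let g : (A ⧸ J) →ₗ[A] (A ⧸ I) := Submodule.mapQ J I (LinearMap.lsmul A A f) le_rfl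
  have hIJ : I ≤ J := fun a ha ↦ I.mul_mem_left f ha
  have hg : Function.Injective g := by
    rw [← LinearMap.ker_eq_bot, Submodule.ker_mapQ]
    simp [J]
  have key : Function.Injective (g.lTensor N) :=
    lTensor_injective_of_flat_quotient I N
      (fun a ha m ↦ Ideal.smul_quotient_eq_zero (hIJ ha) m)
      (fun a ha m ↦ Ideal.smul_quotient_eq_zero ha m) g hg
  have h0 : J.mkQ.lTensor N (x ⊗ₜ 1) = 0 := by
    apply key
    rw [map_zero, LinearMap.lTensor_tmul, LinearMap.lTensor_tmul]
    have : g (J.mkQ 1) = f • I.mkQ 1 := by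
      rw [← map_smul]; rfl
    rw [this, ← TensorProduct.smul_tmul, hx, TensorProduct.zero_tmul]
  obtain ⟨w, hw⟩ := (lTensor_exact N (LinearMap.exact_subtype_mkQ J) J.mkQ_surjective _).1 h0
  rw [← hw]
  clear h0 hw hx
  induction w with
  | zero => exact ⟨0, 0, by simp⟩
  | add a b ha hb =>
    obtain ⟨z, y, h⟩ := ha
    obtain ⟨z', y', h'⟩ := hb
    refine ⟨z + z', y + y', ?_⟩
    rw [map_add, h, h', map_add, smul_add, TensorProduct.add_tmul]
    abel
  | tmul m j =>
    obtain ⟨j, hj⟩ := j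
    obtain ⟨b, hb⟩ := (hI _).1 (show f * j ∈ I from hj)
    have ht : j - b * f ^ n ∈ Submodule.torsionBy A A f := by
      change f * (j - b * f ^ n) = 0
      rw [mul_sub, ← hb]; ring
    refine ⟨m ⊗ₜ ⟨_, ht⟩, b • m, ?_⟩
    rw [LinearMap.lTensor_tmul, LinearMap.lTensor_tmul, smul_smul, TensorProduct.smul_tmul,
      ← TensorProduct.tmul_add]
    simp [mul_comm b]

theorem isTorIndependent_of_flat_quotients
    (hbdd : ∃ c : ℕ, ∀ x : A, (∃ n : ℕ, f ^ n * x = 0) → f ^ c * x = 0)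
    [IsHausdorff (Ideal.span {f}) N]
    (hflat : ∀ n : ℕ, 1 ≤ n →
      Module.Flat (A ⧸ (Ideal.span {f} ^ n)) ((A ⧸ (Ideal.span {f} ^ n)) ⊗[A] N)) :
    IsTorIndependent f N where
  lTensor_injective {M M'} _ _ _ _ j hM hM' hj := by
    have := hflat 1 le_rfl
    have aux : ∀ {L : Type u} [AddCommGroup L] [Module A L], (∀ m : L, f • m = 0) →
        ∀ a ∈ Ideal.span {f} ^ 1, ∀ m : L, a • m = 0 := by
      intro L _ _ hL a ha m
      rw [pow_one] at ha
      obtain ⟨b, rfl⟩ := Ideal.mem_span_singleton'.1 ha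
      rw [mul_smul, hL, smul_zero]
    exact lTensor_injective_of_flat_quotient (Ideal.span {f} ^ 1) N (aux hM) (aux hM') j hj
  torsion_injective := by
    obtain ⟨c, hc⟩ := hbdd
    have := hflat (c + 1) (by omega)
    rw [injective_iff_map_eq_zero]
    intro z hz
    exact lTensor_torsionBy_eq_zero (Nat.le_succ c) (by omega) hc z (by rw [hz, map_zero])
  tmul_one_mem_range x hx := by
    obtain ⟨c, hc⟩ := hbdd
    have hz : ∀ n, ∃ (z : N ⊗[A] Submodule.torsionBy A A f) (y : N), x ⊗ₜ[A] (1 : A) =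
        (Submodule.torsionBy A A f).subtype.lTensor N z + (f ^ n • y) ⊗ₜ[A] (1 : A) := fun n ↦
      have := hflat (n + 1) (by omega)
      exists_tmul_one_eq_add n x hx
    choose z y hzy using hz
    have hconst : ∀ n, z (n + (c + 1)) = z (c + 1) := by
      intro n
      have := hflat (c + 1) (by omega)
      rw [← sub_eq_zero]
      refine lTensor_torsionBy_eq_zero (Nat.le_succ c) (by omega) hc _ ?_
      have h1 : (Submodule.torsionBy A A f).subtype.lTensor N (z (n + (c + 1)) - z (c + 1)) =
          (f ^ (c + 1)) • ((y (c + 1) - f ^ n • y (n + (c + 1))) ⊗ₜ[A] (1 : A)) := by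
        rw [map_sub, TensorProduct.smul_tmul', smul_sub, smul_smul, ← pow_add, add_comm (c + 1) n,
          TensorProduct.sub_tmul, sub_eq_sub_iff_add_eq_add, ← hzy, add_comm, ← hzy]
      rw [h1, map_smul, LinearMap.lTensor_tmul, ← TensorProduct.tmul_smul,
        Ideal.smul_quotient_eq_zero, TensorProduct.tmul_zero]
      exact Ideal.pow_mem_pow (Ideal.mem_span_singleton_self f) _
    refine ⟨z (c + 1), (TensorProduct.rid A N).injective ?_⟩
    rw [← sub_eq_zero, ← neg_eq_zero, neg_sub]
    refine eq_zero_of_forall_pow_smul (f := f) fun n ↦ ?_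
    refine ⟨f ^ (c + 1) • y (n + (c + 1)), ?_⟩
    rw [← hconst n, ← map_sub, hzy (n + (c + 1)), add_sub_cancel_left, TensorProduct.rid_tmul,
      one_smul, smul_smul, ← pow_add]

end FlatQuotients

section DerivedComplete

variable {A : Type u} [CommRing A] {f : A} {N : Type u} [AddCommGroup N] [Module A N]

theorem exists_eq_add_smul_succ [IsAdicComplete (Ideal.span {f}) N] (a : ℕ → N) :
    ∃ m : ℕ → N, ∀ k, m k = a k + f • m (k + 1) := by
  let S : ℕ → ℕ → N := fun k j ↦ ∑ i ∈ Finset.range j, f ^ i • a (k + i)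
  have hS : ∀ k, ∃ L, ∀ j, ∃ y, f ^ j • y = S k j - L := by
    intro k
    obtain ⟨L, hL⟩ :=
        IsPrecomplete.prec (I := Ideal.span {f}) (M := N) inferInstance (f := S k) <| by
      intro i j hij
      rw [SModEq.comm, SModEq.sub_mem, ← Finset.sum_Ico_eq_sub _ hij]
      refine Submodule.sum_mem _ fun l hl ↦ mem_span_singleton_pow_smul_top.2 ?_
      obtain ⟨t, rfl⟩ := Nat.exists_eq_add_of_le (Finset.mem_Ico.1 hl).1
      exact ⟨f ^ t • a (k + (i + t)), by rw [smul_smul, pow_add]⟩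
    exact ⟨L, fun j ↦ mem_span_singleton_pow_smul_top.1 (SModEq.sub_mem.1 (hL j))⟩
  choose m hm using hS
  refine ⟨m, fun k ↦ ?_⟩
  rw [← sub_eq_zero]
  refine eq_zero_of_forall_pow_smul (f := f) fun n ↦ ?_
  obtain ⟨y, hy⟩ := hm k (n + 1)
  obtain ⟨y', hy'⟩ := hm (k + 1) n
  have hrec : S k (n + 1) = a k + f • S (k + 1) n := by
    simp only [S, Finset.sum_range_succ', Finset.smul_sum, smul_smul, pow_zero, one_smul, add_zero,
      ← pow_succ']
    rw [add_comm]
    simp only [add_assoc, add_comm 1]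
  refine ⟨f • y' - f • y, ?_⟩
  rw [smul_sub, smul_smul, smul_smul, ← pow_succ, hy, pow_succ', mul_smul, hy', hrec, smul_sub]
  abel

/-- The vanishing of `Ext¹(A_f, N)`, computed from an arbitrary projective presentation of
`A_f`. -/
theorem exists_extend_of_exact_away [IsAdicComplete (Ideal.span {f}) N]
    {P₁ P₀ : Type u} [AddCommGroup P₁] [Module A P₁] [AddCommGroup P₀] [Module A P₀]
    [Module.Projective A P₀] (d : P₁ →ₗ[A] P₀) (ε : P₀ →ₗ[A] Localization.Away f)
    (hex : Function.Exact d ε) (hε : Function.Surjective ε) (φ : P₁ →ₗ[A] N)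
    (hφ : LinearMap.ker d ≤ LinearMap.ker φ) : ∃ ψ : P₀ →ₗ[A] N, ψ ∘ₗ d = φ := by
  let r : Localization.Away f := IsLocalization.Away.invSelf f
  have hr : f • r = 1 := by
    rw [Algebra.smul_def]; exact IsLocalization.Away.mul_invSelf f
  have hr' : ∀ k n, f ^ n • r ^ (k + n) = r ^ k := by
    intro k n
    rw [pow_add, ← mul_smul_comm, ← smul_pow, hr, one_pow, mul_one]
  let q : (ℕ →₀ A) →ₗ[A] Localization.Away f := Finsupp.linearCombination A (r ^ ·)
  let D : (ℕ →₀ A) →ₗ[A] (ℕ →₀ A) := Finsupp.linearCombination A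
    (fun k ↦ Finsupp.single k 1 - Finsupp.single (k + 1) f)
  have hq : Function.Surjective q := by
    intro x
    obtain ⟨n, a, hx⟩ := IsLocalization.Away.surj f x
    refine ⟨Finsupp.single n a, ?_⟩
    have h1 : a • (1 : Localization.Away f) = f ^ n • x := by
      rw [← Algebra.algebraMap_eq_smul_one, ← hx, Algebra.smul_def, map_pow, mul_comm]
    have h2 : f ^ n • r ^ n = 1 := by rw [← smul_pow, hr, one_pow]
    calc q (Finsupp.single n a) = a • r ^ n := by simp [q]
      _ = (a • (1 : Localization.Away f)) * r ^ n := by rw [smul_mul_assoc, one_mul]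
      _ = x := by rw [h1, smul_mul_assoc, ← mul_smul_comm, h2, mul_one]
  have hD1 : ∀ k n : ℕ,
      (Finsupp.single k 1 : ℕ →₀ A) - f ^ n • (Finsupp.single (k + n) 1 : ℕ →₀ A) ∈
        LinearMap.range D := by
    intro k n
    induction n with
    | zero => simp
    | succ n ih =>
      have : f ^ n • D (Finsupp.single (k + n) 1) ∈ LinearMap.range D :=
        Submodule.smul_mem _ _ ⟨_, rfl⟩
      convert add_mem ih this using 1
      simp [D, smul_sub, pow_succ, add_assoc]
  have hD2 : ∀ x : ℕ →₀ A, ∃ (a : A) (n : ℕ),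
      x - a • (Finsupp.single n 1 : ℕ →₀ A) ∈ LinearMap.range D := by
    intro x
    induction x using Finsupp.induction_linear with
    | zero => exact ⟨0, 0, by simp⟩
    | add x y hx hy =>
      obtain ⟨a, n, hx⟩ := hx
      obtain ⟨b, m, hy⟩ := hy
      refine ⟨a * f ^ m + b * f ^ n, n + m, ?_⟩
      have h1 := Submodule.smul_mem _ a (hD1 n m)
      have h2 := Submodule.smul_mem _ b (hD1 m n)
      convert add_mem (add_mem hx hy) (add_mem h1 h2) using 1
      rw [add_comm m n]
      simp only [smul_sub, smul_smul, add_smul]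
      abel
    | single n a => exact ⟨a, n, by simp⟩
  have hqd : ∀ y, q (D y) = 0 := by
    intro y
    induction y using Finsupp.induction_linear with
    | zero => simp
    | add x y hx hy => rw [map_add, map_add, hx, hy, add_zero]
    | single n a =>
      have h1 := hr' n 1
      rw [pow_one] at h1
      simp [D, q, h1]
  have hqD : LinearMap.ker q ≤ LinearMap.range D := by
    intro x hx
    obtain ⟨a, n, y, hy⟩ := hD2 x
    have h1 : a • r ^ n = 0 := by
      have := hqd y
      rw [hy, map_sub, LinearMap.mem_ker.1 hx] at this
      simpa [q] using this
    have h2 : algebraMap A (Localization.Away f) a = algebraMap A _ 0 := by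
      rw [map_zero, Algebra.algebraMap_eq_smul_one, ← pow_zero r, ← hr' 0 n, zero_add, smul_comm, h1,
        smul_zero]
    obtain ⟨m, hm⟩ := IsLocalization.Away.exists_of_eq f h2
    have h3 := Submodule.smul_mem _ a (hD1 n m)
    rw [smul_sub, smul_smul, mul_comm a, hm, mul_zero, zero_smul, sub_zero] at h3
    have h4 := add_mem (show D y ∈ LinearMap.range D from ⟨y, rfl⟩) h3
    rwa [hy, sub_add_cancel] at h4
  obtain ⟨u, hu⟩ := Module.projective_lifting_property ε q hε
  obtain ⟨v, hv⟩ := Module.projective_lifting_property q ε hq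
  obtain ⟨θ, hθ⟩ : ∃ θ : LinearMap.ker ε →ₗ[A] N, ∀ x h, θ ⟨d x, h⟩ = φ x := by
    let d' : P₁ →ₗ[A] LinearMap.ker ε := d.codRestrict _ hex.apply_apply_eq_zero
    have hd' : Function.Surjective d' := by
      rintro ⟨x, hx⟩
      obtain ⟨y, rfl⟩ := (hex x).1 hx
      exact ⟨y, rfl⟩
    have hk : LinearMap.ker d' = LinearMap.ker d := LinearMap.ker_codRestrict _ _ _
    refine ⟨(LinearMap.ker d').liftQ φ (hk.trans_le hφ) ∘ₗ
      (d'.quotKerEquivOfSurjective hd').symm.toLinearMap, fun x h ↦ ?_⟩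
    have : (d'.quotKerEquivOfSurjective hd').symm ⟨d x, h⟩ = Submodule.Quotient.mk x := by
      rw [LinearEquiv.symm_apply_eq]; rfl
    rw [LinearMap.comp_apply, LinearEquiv.coe_coe, this, Submodule.liftQ_apply]
  have huD : ∀ y, u (D y) ∈ LinearMap.ker ε := by
    intro y
    exact (LinearMap.congr_fun hu (D y)).trans (hqd y)
  obtain ⟨m, hm⟩ := exists_eq_add_smul_succ (f := f)
    (fun k ↦ θ ⟨u (D (Finsupp.single k 1)), huD _⟩)
  let w : (ℕ →₀ A) →ₗ[A] N := Finsupp.linearCombination A m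
  have hw : w ∘ₗ D = θ ∘ₗ (u ∘ₗ D).codRestrict _ huD := by
    ext k
    have h1 : w (D (Finsupp.single k 1)) = m k - f • m (k + 1) := by simp [w, D]
    have h2 : w (D (Finsupp.single k 1)) = θ ⟨u (D (Finsupp.single k 1)), huD _⟩ := by
      rw [h1, hm k, add_sub_cancel_right]
    exact h2
  have hεuv : ∀ p, (LinearMap.id - u ∘ₗ v : P₀ →ₗ[A] P₀) p ∈ LinearMap.ker ε := by
    intro p
    have h1 : ε (u (v p)) = q (v p) := LinearMap.congr_fun hu _
    have h2 : q (v p) = ε p := LinearMap.congr_fun hv _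
    simp [h1, h2]
  refine ⟨θ ∘ₗ (LinearMap.id - u ∘ₗ v).codRestrict _ hεuv + w ∘ₗ v, ?_⟩
  ext x
  have hvx : v (d x) ∈ LinearMap.ker q :=
    (LinearMap.congr_fun hv (d x)).trans (hex.apply_apply_eq_zero x)
  obtain ⟨y, hy⟩ := hqD hvx
  have h1 : w (v (d x)) = θ ⟨u (v (d x)), by rw [← hy]; exact huD y⟩ := by
    have := LinearMap.congr_fun hw y
    simp only [← hy]
    exact this
  have h2 : θ ⟨(LinearMap.id - u ∘ₗ v : P₀ →ₗ[A] P₀) (d x), hεuv _⟩ + w (v (d x)) = φ x := by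
    rw [h1, ← map_add, ← hθ x (hex.apply_apply_eq_zero x)]
    congr 1
    exact Subtype.ext (by simp)
  exact h2

theorem derivedComplete_of_isAdicComplete [IsAdicComplete (Ideal.span {f}) N] :
    DerivedComplete A f N := by
  constructor
  · intro g
    ext x
    refine eq_zero_of_forall_pow_smul (f := f) fun n ↦ ?_
    refine ⟨g (IsLocalization.Away.invSelf f ^ n * x), ?_⟩
    rw [← map_smul, ← smul_mul_assoc, ← smul_pow, Algebra.smul_def,
      IsLocalization.Away.mul_invSelf, one_pow, one_mul]
  · let X := ModuleCat.of A (Localization.Away f)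
    let P := projectiveResolution X
    have hP : Module.Projective A (P.complex.X 0) :=
      (IsProjective.iff_projective (P.complex.X 0)).2 (P.projective 0)
    have hε : Function.Exact (P.complex.d 1 0).hom (P.π.f 0).hom :=
      (ShortComplex.ShortExact.moduleCat_exact_iff_function_exact _).1 P.exact₀
    have hd : Function.Exact (P.complex.d 2 1).hom (P.complex.d 1 0).hom :=
      (ShortComplex.ShortExact.moduleCat_exact_iff_function_exact _).1 (P.exact_succ 0)
    have hs : Function.Surjective (P.π.f 0).hom := (ModuleCat.epi_iff_surjective _).1 inferInstance
    refine ModuleCat.subsingleton_of_isZero ?_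
    refine Limits.IsZero.of_iso ?_ (P.isoExt 1 (ModuleCat.of A N))
    rw [← HomologicalComplex.exactAt_iff_isZero_homology,
      HomologicalComplex.exactAt_iff' _ 0 1 2 (by simp) (by simp),
      ShortComplex.moduleCat_exact_iff]
    intro (φ : P.complex.X 1 ⟶ ModuleCat.of A N) hφ
    have hφ' : P.complex.d 2 1 ≫ φ = 0 := hφ
    obtain ⟨ψ, hψ⟩ := exists_extend_of_exact_away (f := f) (N := N) (P.complex.d 1 0).hom
      (P.π.f 0).hom hε hs φ.hom (fun x hx ↦ by
        obtain ⟨y, rfl⟩ := (hd x).1 hx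
        exact LinearMap.congr_fun (congrArg ModuleCat.Hom.hom hφ') y)
    exact ⟨ModuleCat.ofHom ψ, ModuleCat.hom_ext hψ⟩

end DerivedComplete
/-- If `(A, (f))` is of reduced prismatic type (`A` is derived `f`-complete
with bounded `f^∞`-torsion), and `N` is an `f`-adically complete `A`-module with `N/f^nN` flat
over `A/f^nA` for all `n ≥ 1`, then `N` is `(f)`-completely flat (`Tor_i^A(N, A/fA) = 0` for
`i ≥ 1`) and derived `f`-complete; if moreover each `N/f^nN` is faithfully flat over `A/f^nA`
then `N/fN` is faithfully flat over `A/fA`. -/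
theorem reducedPrismaticType_complete_flat (A : Type u) [CommRing A] (f : A)
    (hder : DerivedComplete A f A)
    (hbdd : ∃ c : ℕ, ∀ x : A, (∃ n : ℕ, f ^ n * x = 0) → f ^ c * x = 0)
    (N : Type u) [AddCommGroup N] [Module A N]
    (hcomplete : IsAdicComplete (Ideal.span {f}) N)
    (hflat : ∀ n : ℕ, 1 ≤ n →
      Module.Flat (A ⧸ (Ideal.span {f} ^ n)) ((A ⧸ (Ideal.span {f} ^ n)) ⊗[A] N)) :
    (TorVanish A N (A ⧸ Ideal.span {f}) ∧ DerivedComplete A f N) ∧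
    ((∀ n : ℕ, 1 ≤ n →
        Module.FaithfullyFlat (A ⧸ (Ideal.span {f} ^ n)) ((A ⧸ (Ideal.span {f} ^ n)) ⊗[A] N)) →
      Module.FaithfullyFlat (A ⧸ Ideal.span {f}) ((A ⧸ Ideal.span {f}) ⊗[A] N)) := by
  have := hcomplete.toIsHausdorff
  refine ⟨⟨(isTorIndependent_of_flat_quotients hbdd hflat).torVanish,
    derivedComplete_of_isAdicComplete⟩, fun h ↦ ?_⟩
  have key : ∀ I J : Ideal A, I = J → Module.FaithfullyFlat (A ⧸ I) ((A ⧸ I) ⊗[A] N) →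
      Module.FaithfullyFlat (A ⧸ J) ((A ⧸ J) ⊗[A] N) := by
    rintro I _ rfl hI
    exact hI
  exact key _ _ (pow_one _) (h 1 le_rfl)
end

section
/- Let A be a commutative ring, f ∈ A, and c ≥ 0 an integer such that A[f^∞] = A[f^c]. Let N be an A-module which is f-adically complete and such that N/f^nN is a flat A/f^nA-module for every n ≥ 1. Then N has bounded f^∞-torsion with the same bound: N[f^∞] = N[f^c], i.e. every element of N killed by some power of f is already killed by f^c. -/
open TensorProduct

universe u

/-- If `f`-power torsion of `A` is killed by `f ^ c`, any element of `A / f ^ (n + k)` killed by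
`f ^ n` becomes divisible by `f ^ k` after multiplication by `f ^ c`. -/
lemma exists_pow_mul_eq_of_quotient_torsion {A : Type*} [CommRing A] {f : A} {c : ℕ}
    (hbdd : ∀ x : A, (∃ n : ℕ, f ^ n * x = 0) → f ^ c * x = 0) {n k : ℕ}
    (a : A ⧸ (Ideal.span {f} ^ (n + k)))
    (ha : Ideal.Quotient.mk _ (f ^ n) * a = 0) :
    ∃ b : A ⧸ (Ideal.span {f} ^ (n + k)), f ^ c • a = f ^ k • b := by
  obtain ⟨a, rfl⟩ := Ideal.Quotient.mk_surjective a
  rw [← map_mul, Ideal.Quotient.eq_zero_iff_mem, Ideal.span_singleton_pow,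
    Ideal.mem_span_singleton] at ha
  obtain ⟨b, hb⟩ := ha
  have h := hbdd (a - f ^ k * b) ⟨n, by rw [mul_sub, hb]; ring⟩
  refine ⟨Ideal.Quotient.mk _ (f ^ c * b), ?_⟩
  rw [Algebra.smul_def, Algebra.smul_def, Ideal.Quotient.algebraMap_eq, ← map_mul, ← map_mul]
  exact congrArg _ (by linear_combination h)

/-- In a flat `A / f ^ (n + k)`-module of the form `N / f ^ (n + k) N`, the class of `f ^ c • x` is
divisible by `f ^ k` whenever `f ^ n • x = 0`. -/
lemma exists_one_tmul_eq_smul_of_flat {A : Type*} [CommRing A] {f : A} {c : ℕ}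
    (hbdd : ∀ x : A, (∃ n : ℕ, f ^ n * x = 0) → f ^ c * x = 0)
    {N : Type*} [AddCommGroup N] [Module A N] {n : ℕ} (k : ℕ) (x : N) (hx : f ^ n • x = 0)
    (hflat : Module.Flat (A ⧸ (Ideal.span {f} ^ (n + k)))
      ((A ⧸ (Ideal.span {f} ^ (n + k))) ⊗[A] N)) :
    ∃ z : (A ⧸ (Ideal.span {f} ^ (n + k))) ⊗[A] N,
      (1 : A ⧸ (Ideal.span {f} ^ (n + k))) ⊗ₜ[A] (f ^ c • x) = f ^ k • z := by
  have hrel : ∑ _i : Unit, (Ideal.Quotient.mk (Ideal.span {f} ^ (n + k)) (f ^ n)) •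
      ((1 : A ⧸ (Ideal.span {f} ^ (n + k))) ⊗ₜ[A] x) = 0 := by
    rw [Fintype.sum_unique, ← Ideal.Quotient.algebraMap_eq, algebraMap_smul,
      ← TensorProduct.tmul_smul, hx, TensorProduct.tmul_zero]
  obtain ⟨m, a, y, hy, ha⟩ := Module.Flat.isTrivialRelation_of_sum_smul_eq_zero hrel
  replace hy := hy ()
  beta_reduce at hy
  choose b hb using fun j => exists_pow_mul_eq_of_quotient_torsion hbdd (a () j)
    (by simpa using ha j)
  refine ⟨∑ j, b j • y j, ?_⟩
  rw [TensorProduct.tmul_smul, hy, Finset.smul_sum, Finset.smul_sum]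
  exact Finset.sum_congr rfl fun j _ => by rw [← smul_assoc, hb, smul_assoc]

/-- If `A[f^∞] = A[f^c]` and `N` is an `f`-adically complete `A`-module with
`N/f^nN` flat over `A/f^nA` for all `n ≥ 1`, then `N[f^∞] = N[f^c]`: every element of `N`
killed by some power of `f` is already killed by `f^c`. -/
theorem boundedTorsion_of_complete_flat (A : Type u) [CommRing A] (f : A) (c : ℕ)
    (hbdd : ∀ x : A, (∃ n : ℕ, f ^ n * x = 0) → f ^ c * x = 0)
    (N : Type u) [AddCommGroup N] [Module A N]
    (hcomplete : IsAdicComplete (Ideal.span {f}) N)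
    (hflat : ∀ n : ℕ, 1 ≤ n →
      Module.Flat (A ⧸ (Ideal.span {f} ^ n)) ((A ⧸ (Ideal.span {f} ^ n)) ⊗[A] N)) :
    ∀ x : N, (∃ n : ℕ, f ^ n • x = 0) → f ^ c • x = 0 := by
  rintro x ⟨n, hx⟩
  refine hcomplete.toIsHausdorff.haus _ fun k => ?_
  rw [SModEq.zero]
  obtain ⟨z, hz⟩ := exists_one_tmul_eq_smul_of_flat hbdd (k + 1) x hx
    (hflat (n + (k + 1)) (by omega))
  have h := congrArg (TensorProduct.quotTensorEquivQuotSMul N (Ideal.span {f} ^ (n + (k + 1)))) hz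
  obtain ⟨w, hw⟩ := Submodule.Quotient.mk_surjective _
    (TensorProduct.quotTensorEquivQuotSMul N (Ideal.span {f} ^ (n + (k + 1))) z)
  rw [map_smul, ← hw, ← map_one (Ideal.Quotient.mk _),
    TensorProduct.quotTensorEquivQuotSMul_mk_tmul, one_smul, ← Submodule.Quotient.mk_smul,
    Submodule.Quotient.eq] at h
  have hle : (Ideal.span {f} ^ (n + (k + 1)) • ⊤ : Submodule A N) ≤ Ideal.span {f} ^ k • ⊤ :=
    Submodule.smul_mono_left (Ideal.pow_le_pow_right (by omega))
  have hmem : f ^ (k + 1) • w ∈ (Ideal.span {f} ^ k • ⊤ : Submodule A N) :=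
    Submodule.smul_mem_smul (Ideal.pow_le_pow_right (Nat.le_succ k)
      (Ideal.pow_mem_pow (Ideal.mem_span_singleton_self f) _)) trivial
  simpa using add_mem (hle h) hmem
end

section
/- Let A be a commutative ring, let ξ, f ∈ A be nonzerodivisors, and let c ≥ 0 be an integer such that (A/ξA)[f^∞] = (A/ξA)[f^c]. Then for every integer n ≥ c and every x ∈ A with ξx ∈ (ξ^n, f^n)A, one has x ∈ (ξ^{n-1}, f^{n-c})A. Consequently, writing A_n = A/(f^n, ξ^n)A, the ξ-torsion submodule A_n[ξ] is contained in the ideal ξ^{n-1}A_n + f^{n-c}A_n for every n ≥ c. -/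
universe u

/-- Let `ξ, f ∈ A` be nonzerodivisors and `c ≥ 0` with
`(A/ξA)[f^∞] = (A/ξA)[f^c]`. Then for `n ≥ c` and `x ∈ A` with `ξx ∈ (ξ^n, f^n)`, one has
`x ∈ (ξ^{n-1}, f^{n-c})`. Consequently, in `A_n = A/(f^n, ξ^n)` the `ξ`-torsion is contained
in the ideal generated by the classes of `ξ^{n-1}` and `f^{n-c}`, for all `n ≥ c`. -/
theorem xi_torsion_bound (A : Type u) [CommRing A] (ξ f : A)
    (hξ : ξ ∈ nonZeroDivisors A) (hf : f ∈ nonZeroDivisors A) (c : ℕ)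
    (hbdd : ∀ a : A, (∃ n : ℕ, f ^ n * a ∈ Ideal.span {ξ}) → f ^ c * a ∈ Ideal.span {ξ}) :
    (∀ n : ℕ, c ≤ n → ∀ x : A, ξ * x ∈ Ideal.span {ξ ^ n, f ^ n} →
      x ∈ Ideal.span {ξ ^ (n - 1), f ^ (n - c)}) ∧
    (∀ n : ℕ, c ≤ n → ∀ y : A ⧸ Ideal.span {f ^ n, ξ ^ n},
      (Ideal.Quotient.mk (Ideal.span {f ^ n, ξ ^ n}) ξ) * y = 0 →
      y ∈ Ideal.span {Ideal.Quotient.mk (Ideal.span {f ^ n, ξ ^ n}) (ξ ^ (n - 1)),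
        Ideal.Quotient.mk (Ideal.span {f ^ n, ξ ^ n}) (f ^ (n - c))}) := by
  have key : ∀ n : ℕ, c ≤ n → ∀ x : A, ξ * x ∈ Ideal.span {ξ ^ n, f ^ n} →
      x ∈ Ideal.span {ξ ^ (n - 1), f ^ (n - c)} := by
    intro n hn x hx
    rcases n with _ | m
    · simp
    obtain ⟨k, hk⟩ := Nat.exists_eq_add_of_le hn
    obtain ⟨a, b, hab⟩ := Ideal.mem_span_pair.1 hx
    have hb : f ^ (m + 1) * b ∈ Ideal.span {ξ} :=
      Ideal.mem_span_singleton.2 ⟨x - a * ξ ^ m, by linear_combination hab⟩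
    obtain ⟨d, hd⟩ := Ideal.mem_span_singleton.1 (hbdd b ⟨m + 1, hb⟩)
    refine Ideal.mem_span_pair.2 ⟨a, d, (mul_cancel_left_mem_nonZeroDivisors hξ).1 ?_⟩
    have hsub : m + 1 - c = k := by omega
    have hpow : f ^ (m + 1) = f ^ c * f ^ k := by rw [hk, pow_add]
    rw [hsub, Nat.add_sub_cancel]
    linear_combination hab - b * hpow - f ^ k * hd
  refine ⟨key, fun n hn y hy => ?_⟩
  obtain ⟨x, rfl⟩ := Ideal.Quotient.mk_surjective y
  rw [← map_mul, Ideal.Quotient.eq_zero_iff_mem, Set.pair_comm] at hy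
  have hmem := Ideal.mem_map_of_mem (Ideal.Quotient.mk (Ideal.span {f ^ n, ξ ^ n})) (key n hn x hy)
  rwa [Ideal.map_span, Set.image_pair] at hmem
end

section
/- Let A be a commutative ring, ξ, f ∈ A nonzerodivisors, and c ≥ 0 an integer such that (A/ξA)[f^∞] = (A/ξA)[f^c]. Put J = (ξ, f) and let N be an A-module which is J-adically complete and such that N/J^nN is a flat A/J^n-module for every n ≥ 1. Set N_n = N/(f^n, ξ^n)N. Then: (a) for every n ≥ 1, the map N_{n+c+1}[ξ] → N_n[ξ] induced by the canonical quotient N_{n+c+1} → N_n is zero; (b) multiplication by ξ on N is injective; (c) the canonical map N/ξN → lim_n N/(ξN + f^nN) is an isomorphism, i.e. N/ξN is f-adically complete. -/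
open TensorProduct

universe u

/-- If `N / KN` is flat over `A / K`, then modulo any ideal `I ⊇ K` the `s`-torsion of `N / IN`
comes from the `s`-torsion of `A / I`. -/
theorem Ideal.mem_smul_top_of_smul_mem_of_flat_quotient {A N : Type*} [CommRing A]
    [AddCommGroup N] [Module A N] {K I L : Ideal A} (hKI : K ≤ I)
    [Module.Flat (A ⧸ K) ((A ⧸ K) ⊗[A] N)] {s : A} (hL : ∀ a, s * a ∈ I → a ∈ L) {x : N}
    (hx : s • x ∈ I • (⊤ : Submodule A N)) : x ∈ L • (⊤ : Submodule A N) := by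
  let _ : Algebra (A ⧸ K) (A ⧸ I) := (Ideal.Quotient.factor hKI).toAlgebra
  have : IsScalarTower A (A ⧸ K) (A ⧸ I) := IsScalarTower.of_algebraMap_eq fun _ ↦ rfl
  have : Module.Flat (A ⧸ I) ((A ⧸ I) ⊗[A] N) :=
    Module.Flat.of_linearEquiv
      (AlgebraTensorModule.cancelBaseChange A (A ⧸ K) (A ⧸ I) (A ⧸ I) N).symm
  let e := quotTensorEquivQuotSMul N I
  have hrel : ∑ _i : Unit, (Ideal.Quotient.mk I s) • ((1 : A ⧸ I) ⊗ₜ[A] x) = 0 := by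
    have h0 : e (s • ((1 : A ⧸ I) ⊗ₜ[A] x)) = 0 := by
      rw [map_smul, quotTensorEquivQuotSMul_mk_one_tmul, ← Submodule.Quotient.mk_smul,
        Submodule.Quotient.mk_eq_zero]
      exact hx
    rw [Fintype.sum_unique]
    exact e.map_eq_zero_iff.mp h0
  obtain ⟨k, a, y, hxy, ha⟩ := Module.Flat.isTrivialRelation_of_sum_smul_eq_zero hrel
  choose b hb using fun j ↦ Ideal.Quotient.mk_surjective (a () j)
  choose z hz using fun j ↦ Submodule.Quotient.mk_surjective _ (e (y j))
  have hbL : ∀ j, b j ∈ L := fun j ↦ hL _ <| by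
    have := ha j
    rw [Fintype.sum_unique, ← hb j, ← map_mul] at this
    exact Ideal.Quotient.eq_zero_iff_mem.mp this
  have hmk : (Submodule.Quotient.mk x : N ⧸ I • (⊤ : Submodule A N)) =
      Submodule.Quotient.mk (∑ j, b j • z j) := by
    have h1 : (1 : A ⧸ I) ⊗ₜ[A] x = ∑ j, b j • y j := by
      refine (hxy ()).trans (Finset.sum_congr rfl fun j _ ↦ ?_)
      rw [← hb j]
      rfl
    rw [← quotTensorEquivQuotSMul_mk_one_tmul, h1, map_sum, ← Submodule.mkQ_apply, map_sum]
    refine Finset.sum_congr rfl fun j _ ↦ ?_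
    rw [map_smul, map_smul, Submodule.mkQ_apply, hz]
  have hIL : I ≤ L := fun r hr ↦ hL r (I.mul_mem_left s hr)
  rw [Submodule.Quotient.eq] at hmk
  rw [← sub_add_cancel x (∑ j, b j • z j)]
  exact Submodule.add_mem _ (Submodule.smul_mono_left hIL hmk)
    (Submodule.sum_mem _ fun j _ ↦ Submodule.smul_mem_smul (hbL j) Submodule.mem_top)

theorem Submodule.mem_span_pair_smul_top {A N : Type*} [CommRing A] [AddCommGroup N] [Module A N]
    {a b : A} {x : N} :
    x ∈ Ideal.span {a, b} • (⊤ : Submodule A N) ↔ ∃ y z : N, x = a • y + b • z := by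
  rw [Ideal.span_insert, Submodule.sup_smul, Submodule.ideal_span_singleton_smul,
    Submodule.ideal_span_singleton_smul, Submodule.mem_sup]
  simp only [Submodule.mem_smul_pointwise_iff_exists, Submodule.mem_top, true_and]
  grind

theorem Submodule.Quotient.mk_mem_span_singleton_pow_smul_top {A N : Type*} [CommRing A]
    [AddCommGroup N] [Module A N] {a b : A} {n : ℕ} {x : N} :
    (mk x : N ⧸ Ideal.span {b} • (⊤ : Submodule A N)) ∈ Ideal.span {a} ^ n • (⊤ : Submodule A _) ↔
      ∃ y z : N, x = a ^ n • y + b • z := by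
  rw [Ideal.span_singleton_pow, Submodule.ideal_span_singleton_smul (a ^ n),
    Submodule.mem_smul_pointwise_iff_exists]
  constructor
  · rintro ⟨y, -, hy⟩
    obtain ⟨y, rfl⟩ := mk_surjective _ y
    rw [← mk_smul, eq_comm, Submodule.Quotient.eq, Submodule.ideal_span_singleton_smul,
      Submodule.mem_smul_pointwise_iff_exists] at hy
    obtain ⟨z, -, hz⟩ := hy
    exact ⟨y, z, by rw [hz]; abel⟩
  · rintro ⟨y, z, rfl⟩
    refine ⟨mk y, trivial, ?_⟩
    rw [← mk_smul, eq_comm, Submodule.Quotient.eq, add_sub_cancel_left]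
    exact Submodule.smul_mem_smul (Ideal.mem_span_singleton_self b) trivial

theorem Ideal.span_pow_pair_le_span_pair_pow {A : Type*} [CommRing A] (a b : A) (n : ℕ) :
    Ideal.span {a ^ n, b ^ n} ≤ Ideal.span {b, a} ^ n := by
  rw [Ideal.span_le]
  rintro _ (rfl | rfl)
  · exact Ideal.pow_mem_pow (Ideal.subset_span (by simp)) n
  · exact Ideal.pow_mem_pow (Ideal.subset_span (by simp)) n

theorem Ideal.span_pair_pow_add_le {A : Type*} [CommRing A] (a b : A) (m n : ℕ) :
    Ideal.span {b, a} ^ (m + n) ≤ Ideal.span {a ^ m, b ^ n} := by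
  rw [Set.pair_comm, Ideal.span_insert, Ideal.span_insert, ← Ideal.span_singleton_pow,
    ← Ideal.span_singleton_pow]
  exact Ideal.sup_pow_add_le_pow_sup_pow

/-- If the `f`-power torsion of `A / ξA` is killed by `f ^ c`, then `ξ`-torsion modulo
`(f ^ (n + c + 1), ξ ^ (n + c + 1))` vanishes modulo `(f ^ n, ξ ^ n)`. -/
theorem Ideal.mem_span_pow_pair_of_mul_mem {A : Type*} [CommRing A] {ξ f : A}
    (hξ : ξ ∈ nonZeroDivisors A) {c : ℕ}
    (hbdd : ∀ a : A, (∃ n : ℕ, f ^ n * a ∈ Ideal.span {ξ}) → f ^ c * a ∈ Ideal.span {ξ})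
    {n : ℕ} {a : A} (ha : ξ * a ∈ Ideal.span {f ^ (n + c + 1), ξ ^ (n + c + 1)}) :
    a ∈ Ideal.span {f ^ n, ξ ^ n} := by
  obtain ⟨u, v, huv⟩ := Ideal.mem_span_pair.mp ha
  obtain ⟨w, hw⟩ := Ideal.mem_span_singleton'.mp <| hbdd u ⟨n + c + 1,
    Ideal.mem_span_singleton'.mpr ⟨a - v * ξ ^ (n + c), by linear_combination -huv⟩⟩
  refine Ideal.mem_span_pair.mpr ⟨f * w, v * ξ ^ c, ?_⟩
  refine (mul_cancel_left_mem_nonZeroDivisors hξ).mp ?_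
  linear_combination huv + f ^ (n + 1) * hw

/-- A bounded-loss form of `ξ`-torsion-freeness in the inverse system `N / (ξ, f) ^ n N` makes
`N / ξN` Hausdorff for the `f`-adic topology. -/
theorem IsHausdorff.quotient_span_singleton_smul_top {A N : Type*} [CommRing A] [AddCommGroup N]
    [Module A N] {ξ f : A} [IsAdicComplete (Ideal.span {ξ, f}) N] (k : ℕ)
    (htors : ∀ (n : ℕ) (x y : N), ξ • x = f ^ (n + k) • y →
      x ∈ Ideal.span {ξ, f} ^ n • (⊤ : Submodule A N)) :
    IsHausdorff (Ideal.span {f}) (N ⧸ Ideal.span {ξ} • (⊤ : Submodule A N)) := by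
  refine ⟨fun x hx ↦ ?_⟩
  obtain ⟨x, rfl⟩ := Submodule.Quotient.mk_surjective _ x
  choose y z hyz using fun n ↦
    Submodule.Quotient.mk_mem_span_singleton_pow_smul_top.mp (SModEq.zero.mp (hx n))
  obtain ⟨L, hL⟩ := IsPrecomplete.prec (I := Ideal.span {ξ, f}) (M := N) inferInstance
    (f := fun n ↦ z (n + k)) fun {m n} hmn ↦ by
      refine SModEq.sub_mem.mpr (htors m _ (f ^ (n - m) • y (n + k) - y (m + k)) ?_)
      have h1 := hyz (m + k)
      have h2 := hyz (n + k)
      rw [smul_sub, smul_sub, smul_smul, ← pow_add, show m + k + (n - m) = n + k by omega,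
        sub_eq_sub_iff_add_eq_add, add_comm, ← h1, ← h2]
  have hxL : x = ξ • L := by
    refine IsHausdorff.eq_iff_smodEq (I := Ideal.span {ξ, f}).mpr fun n ↦ SModEq.sub_mem.mpr ?_
    have hz := SModEq.sub_mem.mp (hL n)
    have : x - ξ • L = f ^ (n + k) • y (n + k) + ξ • (z (n + k) - L) := by
      rw [smul_sub, ← add_sub_assoc, ← hyz]
    rw [this, pow_add, mul_smul]
    exact add_mem (Submodule.smul_mem_smul
      (Ideal.pow_mem_pow (Ideal.subset_span (by simp)) n) trivial) (Submodule.smul_mem _ _ hz)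
  rw [Submodule.Quotient.mk_eq_zero, hxL]
  exact Submodule.smul_mem_smul (Ideal.mem_span_singleton_self ξ) trivial

theorem IsPrecomplete.quotient_span_singleton_smul_top {A N : Type*} [CommRing A]
    [AddCommGroup N] [Module A N] {ξ f : A} [IsPrecomplete (Ideal.span {ξ, f}) N] :
    IsPrecomplete (Ideal.span {f}) (N ⧸ Ideal.span {ξ} • (⊤ : Submodule A N)) := by
  refine ⟨fun F hF ↦ ?_⟩
  choose g hg using fun n ↦ Submodule.Quotient.mk_surjective _ (F n)
  have hstep : ∀ n, ∃ y z : N, g (n + 1) - g n = f ^ n • y + ξ • z := fun n ↦ by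
    rw [← Submodule.Quotient.mk_mem_span_singleton_pow_smul_top, Submodule.Quotient.mk_sub, hg, hg]
    exact SModEq.sub_mem.mp (hF n.le_succ).symm
  choose y z hyz using hstep
  let G : ℕ → N := fun n ↦ g 0 + ∑ i ∈ Finset.range n, f ^ i • y i
  have hGs : ∀ n, G (n + 1) = G n + f ^ n • y n := fun n ↦ by
    simp only [G, Finset.sum_range_succ, add_assoc]
  have hG : ∀ n, Submodule.Quotient.mk (G n) = F n := by
    intro n
    rw [← hg, Submodule.Quotient.eq]
    induction n with
    | zero => simp [G]
    | succ n ih =>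
      have : G (n + 1) - g (n + 1) = (G n - g n) - ξ • z n := by
        rw [hGs, ← sub_add_cancel (g (n + 1)) (g n), hyz]
        abel
      rw [this]
      exact sub_mem ih (Submodule.smul_mem_smul (Ideal.mem_span_singleton_self ξ) trivial)
  have hcauchy : AdicCompletion.IsAdicCauchy (Ideal.span {ξ, f}) N G := by
    refine (AdicCompletion.isAdicCauchy_iff _ _ G).mpr fun n ↦ SModEq.symm ?_
    rw [SModEq.sub_mem, hGs, add_sub_cancel_left]
    exact Submodule.smul_mem_smul (Ideal.pow_mem_pow (Ideal.subset_span (by simp)) n) trivial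
  obtain ⟨L, hL⟩ := IsPrecomplete.prec (I := Ideal.span {ξ, f}) (M := N) inferInstance hcauchy
  refine ⟨Submodule.Quotient.mk L, fun n ↦ (hF n.le_succ).trans ?_⟩
  rw [← hG, SModEq.sub_mem, ← Submodule.Quotient.mk_sub,
    Submodule.Quotient.mk_mem_span_singleton_pow_smul_top]
  have h := Submodule.smul_mono_left (Ideal.span_pair_pow_add_le f ξ n 1)
    (SModEq.sub_mem.mp (hL (n + 1)))
  rwa [pow_one, Submodule.mem_span_pair_smul_top] at h

/-- Let `ξ, f ∈ A` be nonzerodivisors, `c ≥ 0` with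
`(A/ξA)[f^∞] = (A/ξA)[f^c]`, `J = (ξ, f)`, and `N` a `J`-adically complete `A`-module with
`N/J^nN` flat over `A/J^n` for all `n ≥ 1`. With `N_n = N/(f^n, ξ^n)N`:
(a) the map `N_{n+c+1}[ξ] → N_n[ξ]` is zero for all `n ≥ 1`;
(b) multiplication by `ξ` on `N` is injective;
(c) `N/ξN` is `f`-adically complete. -/
theorem xi_torsionFree_and_complete (A : Type u) [CommRing A] (ξ f : A)
    (hξ : ξ ∈ nonZeroDivisors A) (hf : f ∈ nonZeroDivisors A) (c : ℕ)
    (hbdd : ∀ a : A, (∃ n : ℕ, f ^ n * a ∈ Ideal.span {ξ}) → f ^ c * a ∈ Ideal.span {ξ})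
    (N : Type u) [AddCommGroup N] [Module A N]
    (hcomplete : IsAdicComplete (Ideal.span {ξ, f}) N)
    (hflat : ∀ n : ℕ, 1 ≤ n →
      Module.Flat (A ⧸ (Ideal.span {ξ, f} ^ n)) ((A ⧸ (Ideal.span {ξ, f} ^ n)) ⊗[A] N)) :
    -- (a)
    (∀ n : ℕ, 1 ≤ n → ∀ x : N,
      ξ • x ∈ (Ideal.span {f ^ (n + c + 1), ξ ^ (n + c + 1)} • (⊤ : Submodule A N)) →
      x ∈ (Ideal.span {f ^ n, ξ ^ n} • (⊤ : Submodule A N))) ∧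
    -- (b)
    (Function.Injective (fun x : N => ξ • x)) ∧
    -- (c)
    IsAdicComplete (Ideal.span {f}) (N ⧸ (Ideal.span {ξ} • (⊤ : Submodule A N))) := by
  have hJ := Ideal.span_pow_pair_le_span_pair_pow f ξ
  have ha : ∀ n : ℕ, ∀ x : N,
      ξ • x ∈ (Ideal.span {f ^ (n + c + 1), ξ ^ (n + c + 1)} • (⊤ : Submodule A N)) →
      x ∈ (Ideal.span {f ^ n, ξ ^ n} • (⊤ : Submodule A N)) := fun n x hx ↦ by
    have := hflat (n + c + 1 + (n + c + 1)) (by omega)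
    exact Ideal.mem_smul_top_of_smul_mem_of_flat_quotient (Ideal.span_pair_pow_add_le f ξ _ _)
      (fun _ ↦ Ideal.mem_span_pow_pair_of_mul_mem hξ hbdd) hx
  refine ⟨fun n _ ↦ ha n, ?_, ?_⟩
  · refine (injective_iff_map_eq_zero (DistribSMul.toAddMonoidHom N ξ)).mpr fun x hx ↦ ?_
    refine hcomplete.toIsHausdorff.haus x fun n ↦ SModEq.zero.mpr ?_
    refine Submodule.smul_mono_left (hJ n) (ha n x ?_)
    rw [show ξ • x = 0 from hx]
    exact zero_mem _
  · have : IsHausdorff (Ideal.span {f}) (N ⧸ (Ideal.span {ξ} • (⊤ : Submodule A N))) :=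
      IsHausdorff.quotient_span_singleton_smul_top (c + 1) fun n x y hxy ↦
        Submodule.smul_mono_left (hJ n) <| ha n x <|
          Submodule.mem_span_pair_smul_top.mpr ⟨y, 0, by rw [hxy, smul_zero, add_zero, add_assoc]⟩
    have : IsPrecomplete (Ideal.span {f}) (N ⧸ (Ideal.span {ξ} • (⊤ : Submodule A N))) :=
      IsPrecomplete.quotient_span_singleton_smul_top
    exact {}
end

section
/- Let (A,(f)) be of reduced prismatic type. Let B be a derived f-complete A-algebra which is (f)-completely faithfully flat, i.e. Tor_i^A(B, A/fA) = 0 for all i ≥ 1 and B/fB is faithfully flat over A/fA. Let M be an A-module which is f-adically complete and such that M/f^nM is flat over A/f^nA for every n ≥ 1. For m ≥ 0 let M ⊗̂_A B^{⊗(m+1)} denote the f-adic completion of M ⊗_A B ⊗_A ⋯ ⊗_A B (with m+1 tensor factors B). Then the augmented completed Amitsur complex 0 → M → M ⊗̂_A B → M ⊗̂_A B^{⊗2} → M ⊗̂_A B^{⊗3} → ⋯, whose augmentation is x ↦ x ⊗ 1 and whose differential in degree m is the alternating sum Σ_{i=0}^{m+1} (−1)^i of the completed maps inserting 1 into the i-th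 slot of the B-factors, is exact. In particular, M is the equalizer of the two natural maps M ⊗̂_A B ⇉ M ⊗̂_A (B ⊗_A B) induced by b ↦ b ⊗ 1 and b ↦ 1 ⊗ b. -/
set_option synthInstance.maxHeartbeats 400000

open TensorProduct CategoryTheory

universe u

/-- A bundled commutative `A`-algebra. -/
structure AlgB (A : Type u) [CommRing A] : Type (u + 1) where
  carrier : Type u
  [cRing : CommRing carrier]
  [alg : Algebra A carrier]

attribute [instance] AlgB.cRing AlgB.alg

variable (A B : Type u) [CommRing A] [CommRing B] [Algebra A B]

/-- `Bpow A B m` is the `m`-fold tensor power `B ⊗[A] ⋯ ⊗[A] B` (with `Bpow A B 0 = A`). -/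
noncomputable def Bpow : ℕ → AlgB A
  | 0 => AlgB.mk A
  | (m + 1) => AlgB.mk (TensorProduct A (Bpow m).carrier B)

/-- The `A`-algebra map `B^{⊗m} → B^{⊗(m+1)}` inserting `1` into the `i`-th slot. -/
noncomputable def faceMap : (m : ℕ) → Fin (m + 1) →
    ((Bpow A B m).carrier →ₐ[A] (Bpow A B (m + 1)).carrier)
  | 0, _ => Algebra.ofId A (Bpow A B 1).carrier
  | (m + 1), i => Fin.lastCases
      (Algebra.TensorProduct.includeLeft)
      (fun j => Algebra.TensorProduct.map (faceMap m j) (AlgHom.id A B)) i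

variable (f : A) (M : Type u) [AddCommGroup M] [Module A M]

/-- The `m`-th term `(M ⊗̂_A B^{⊗(m+1)})` of the completed Amitsur complex, i.e. the
`f`-adic completion of `M ⊗_A B ⊗_A ⋯ ⊗_A B` with `m + 1` tensor factors `B`. -/
noncomputable def AmitsurTerm (m : ℕ) : Type u :=
  AdicCompletion (Ideal.span {f}) (M ⊗[A] (Bpow A B (m + 1)).carrier)

noncomputable instance (m : ℕ) : AddCommGroup (AmitsurTerm A B f M m) :=
  inferInstanceAs
    (AddCommGroup (AdicCompletion (Ideal.span {f}) (M ⊗[A] (Bpow A B (m + 1)).carrier)))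

noncomputable instance (m : ℕ) : Module A (AmitsurTerm A B f M m) :=
  inferInstanceAs
    (Module A (AdicCompletion (Ideal.span {f}) (M ⊗[A] (Bpow A B (m + 1)).carrier)))

/-- The Amitsur differential in degree `m`: the alternating sum
`Σ_{i=0}^{m+1} (-1)^i` of the completed maps inserting `1` into the `i`-th slot of the
`B`-factors. -/
noncomputable def amitsurD (m : ℕ) : AmitsurTerm A B f M m →ₗ[A] AmitsurTerm A B f M (m + 1) :=
  ∑ i : Fin (m + 2), ((-1 : ℤ) ^ (i : ℕ)) •
    ((AdicCompletion.map (Ideal.span {f})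
        (LinearMap.lTensor M (faceMap A B (m + 1) i).toLinearMap)).restrictScalars A)

/-- The augmentation `M → (M ⊗̂_A B)`, `x ↦ x ⊗ 1`. -/
noncomputable def amitsurAug : M →ₗ[A] AmitsurTerm A B f M 0 :=
  (AdicCompletion.of (Ideal.span {f}) (M ⊗[A] (Bpow A B 1).carrier)).comp
    ((TensorProduct.mk A M (Bpow A B 1).carrier).flip 1)


section TorOneZero

variable {A : Type u} [CommRing A]

/-- `Tor₁(N, B) = 0`, expressed through presentations of `N`: tensoring with `B` keeps the
inclusion of the kernel of any surjection onto `N` injective. -/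
def TorOneZero (B N : Type u) [AddCommGroup B] [Module A B] [AddCommGroup N] [Module A N] : Prop :=
  ∀ (Q : Type u) [AddCommGroup Q] [Module A Q] (g : Q →ₗ[A] N), Function.Surjective g →
    Function.Injective ((LinearMap.ker g).subtype.rTensor B)

variable {B : Type u} [AddCommGroup B] [Module A B]

theorem TorOneZero.injective_of_exact {N K Q : Type u} [AddCommGroup N] [Module A N]
    [AddCommGroup K] [Module A K] [AddCommGroup Q] [Module A Q]
    (h : TorOneZero (A := A) B N) {i : K →ₗ[A] Q} {g : Q →ₗ[A] N} (hi : Function.Injective i)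
    (hig : Function.Exact i g) (hg : Function.Surjective g) :
    Function.Injective (i.rTensor B) := by
  have hr : LinearMap.range i = LinearMap.ker g := (LinearMap.exact_iff.mp hig).symm
  let e : K ≃ₗ[A] LinearMap.ker g :=
    (LinearEquiv.ofInjective i hi).trans (LinearEquiv.ofEq _ _ hr)
  have he : i = (LinearMap.ker g).subtype ∘ₗ e.toLinearMap := by ext; rfl
  rw [he, LinearMap.rTensor_comp]
  exact (h Q g hg).comp (LinearEquiv.rTensor B e).injective

theorem torOneZero_of_projective {N K P : Type u} [AddCommGroup N] [Module A N]
    [AddCommGroup K] [Module A K] [AddCommGroup P] [Module A P] [Module.Projective A P]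
    {j : K →ₗ[A] P} {p : P →ₗ[A] N} (hjp : Function.Exact (j : K → P) (p : P → N))
    (hp : Function.Surjective p)
    (h : Function.Injective (j.rTensor B)) : TorOneZero (A := A) B N := by
  intro Q _ _ g hg
  obtain ⟨φ, hφ⟩ := Module.projective_lifting_property g p hg
  have hφ' : ∀ x, g (φ x) = p x := fun x => LinearMap.congr_fun hφ x
  let ψ : K →ₗ[A] LinearMap.ker g := (φ ∘ₗ j).codRestrict _ fun k => by
    simpa [hφ'] using hjp.apply_apply_eq_zero k
  let a : K →ₗ[A] (LinearMap.ker g) × P := ψ.prod j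
  let b : (LinearMap.ker g) × P →ₗ[A] Q := (LinearMap.ker g).subtype.coprod (-φ)
  have hab : Function.Exact a b := by
    rintro ⟨x, y⟩
    constructor
    · intro hxy
      have hxy : (x : Q) = φ y := by simpa [b, ← sub_eq_add_neg, sub_eq_zero] using hxy
      have : p y = 0 := by rw [← hφ', ← hxy]; exact x.2
      obtain ⟨k, rfl⟩ := (hjp y).mp this
      exact ⟨k, Prod.ext (Subtype.ext hxy.symm) rfl⟩
    · rintro ⟨k, hk⟩
      rw [← hk]
      simp [a, b, ψ]
  have hb : Function.Surjective b := by
    intro q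
    obtain ⟨y, hy⟩ := hp (g q)
    exact ⟨(⟨q - φ y, by simp [hφ', hy]⟩, -y), by simp [b]⟩
  have hex := rTensor_exact B hab hb
  rw [injective_iff_map_eq_zero]
  intro z hz
  have : (b.rTensor B) ((LinearMap.inl A (LinearMap.ker g) P).rTensor B z) = 0 := by
    rw [← LinearMap.rTensor_comp_apply]
    convert hz using 3
    ext; simp [b]
  obtain ⟨w, hw⟩ := (hex _).mp this
  have hw0 : w = 0 := by
    apply h
    have := congrArg ((LinearMap.snd A (LinearMap.ker g) P).rTensor B) hw
    rw [← LinearMap.rTensor_comp_apply, ← LinearMap.rTensor_comp_apply, LinearMap.snd_comp_inl,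
      LinearMap.rTensor_zero] at this
    simpa [a] using this
  have := congrArg ((LinearMap.fst A (LinearMap.ker g) P).rTensor B) hw
  rw [hw0, map_zero, map_zero, ← LinearMap.rTensor_comp_apply, LinearMap.fst_comp_inl] at this
  simpa using this.symm

theorem exists_free_presentation (N : Type u) [AddCommGroup N] [Module A N] :
    ∃ (P : Type u) (_ : AddCommGroup P) (_ : Module A P) (_ : Module.Free A P)
      (q : P →ₗ[A] N), Function.Surjective q :=
  ⟨N →₀ A, inferInstance, inferInstance, inferInstance, Finsupp.linearCombination A id,
    Finsupp.linearCombination_id_surjective A N⟩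

theorem TorOneZero.of_exact {N' N N'' : Type u} [AddCommGroup N'] [Module A N']
    [AddCommGroup N] [Module A N] [AddCommGroup N''] [Module A N'']
    {i : N' →ₗ[A] N} {p : N →ₗ[A] N''} (hi : Function.Injective i) (hip : Function.Exact i p)
    (hp : Function.Surjective p) (h' : TorOneZero (A := A) B N')
    (h'' : TorOneZero (A := A) B N'') : TorOneZero (A := A) B N := by
  intro Q _ _ g hg
  have hle : LinearMap.ker g ≤ LinearMap.ker (p ∘ₗ g) := fun x hx => by
    simp [LinearMap.mem_ker.mp hx]
  let e := LinearEquiv.ofInjective i hi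
  let r : LinearMap.ker (p ∘ₗ g) →ₗ[A] N' := e.symm.toLinearMap ∘ₗ
    (g ∘ₗ (LinearMap.ker (p ∘ₗ g)).subtype).codRestrict (LinearMap.range i) fun x =>
      (hip _).mp x.2
  have hir : ∀ x, i (r x) = g x := fun x => congrArg Subtype.val (e.apply_symm_apply _)
  have h1 : Function.Injective ((Submodule.inclusion hle).rTensor B) := by
    refine h'.injective_of_exact (g := r) (Submodule.inclusion_injective hle) ?_ ?_
    · intro x
      rw [← map_eq_zero_iff i hi, hir]
      exact ⟨fun hx => ⟨⟨x, hx⟩, rfl⟩, by rintro ⟨y, rfl⟩; exact y.2⟩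
    · intro n
      obtain ⟨q, hq⟩ := hg (i n)
      refine ⟨⟨q, ?_⟩, hi ?_⟩
      · simp [hq, hip.apply_apply_eq_zero]
      · rw [hir, hq]
  have h2 := h'' Q (p ∘ₗ g) (hp.comp hg)
  have : (LinearMap.ker g).subtype =
    (LinearMap.ker (p ∘ₗ g)).subtype ∘ₗ Submodule.inclusion hle := rfl
  rw [this, LinearMap.rTensor_comp]
  exact h2.comp h1

theorem TorOneZero.of_injective_of_exact {K F N : Type u} [AddCommGroup K] [Module A K]
    [AddCommGroup F] [Module A F] [AddCommGroup N] [Module A N] {i : K →ₗ[A] F} {p : F →ₗ[A] N}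
    (hip : Function.Exact i p) (hp : Function.Surjective p)
    (hF : TorOneZero (A := A) B F) (hi : Function.Injective i)
    (hinj : Function.Injective (i.rTensor B)) : TorOneZero (A := A) B N := by
  obtain ⟨P, _, _, _, q, hq⟩ := exists_free_presentation (A := A) F
  refine torOneZero_of_projective (p := p ∘ₗ q)
    (j := (LinearMap.ker (p ∘ₗ q)).subtype)
    (LinearMap.exact_subtype_ker_map _) (hp.comp hq) ?_
  have hle : LinearMap.ker q ≤ LinearMap.ker (p ∘ₗ q) := fun x hx => by
    simp [LinearMap.mem_ker.mp hx]
  let e := LinearEquiv.ofInjective i hi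
  let r : LinearMap.ker (p ∘ₗ q) →ₗ[A] K := e.symm.toLinearMap ∘ₗ
    (q ∘ₗ (LinearMap.ker (p ∘ₗ q)).subtype).codRestrict (LinearMap.range i) fun x =>
      (hip _).mp x.2
  have hir : i ∘ₗ r = q ∘ₗ (LinearMap.ker (p ∘ₗ q)).subtype :=
    LinearMap.ext fun x => congrArg Subtype.val (e.apply_symm_apply _)
  have hir' : ∀ x, i (r x) = q x := LinearMap.congr_fun hir
  have hr : Function.Surjective r := by
    intro k
    obtain ⟨y, hy⟩ := hq (i k)
    exact ⟨⟨y, by simp [hy, hip.apply_apply_eq_zero]⟩, hi (by rw [hir', hy])⟩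
  have hex : Function.Exact (Submodule.inclusion hle) r := by
    intro x
    rw [← map_eq_zero_iff i hi, hir']
    exact ⟨fun hx => ⟨⟨x, hx⟩, rfl⟩, by rintro ⟨y, rfl⟩; exact y.2⟩
  rw [injective_iff_map_eq_zero]
  intro z hz
  have h0 : r.rTensor B z = 0 := by
    apply hinj
    rw [map_zero, ← LinearMap.rTensor_comp_apply, hir, LinearMap.rTensor_comp_apply, hz, map_zero]
  obtain ⟨w, rfl⟩ := (rTensor_exact B hex hr z).mp h0
  rw [← LinearMap.rTensor_comp_apply] at hz
  rw [hF _ q hq (hz.trans (map_zero _).symm), map_zero]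

theorem TorOneZero.finsupp {N : Type u} [AddCommGroup N] [Module A N]
    (h : TorOneZero (A := A) B N) (ι : Type u) : TorOneZero (A := A) B (ι →₀ N) := by
  classical
  obtain ⟨P, _, _, _, q, hq⟩ := exists_free_presentation (A := A) N
  refine torOneZero_of_projective (p := Finsupp.mapRange.linearMap (α := ι) q)
    (j := Finsupp.mapRange.linearMap (α := ι) (LinearMap.ker q).subtype) ?_ ?_ ?_
  · rw [LinearMap.exact_iff, Finsupp.ker_mapRange, Finsupp.range_mapRange_linearMap _
      (Submodule.ker_subtype _), Submodule.range_subtype]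
  · exact Finsupp.mapRange_surjective _ (map_zero q) hq
  · have hsq : (TensorProduct.finsuppLeft A A P B ι).toLinearMap ∘ₗ
        (Finsupp.mapRange.linearMap (α := ι) (LinearMap.ker q).subtype).rTensor B =
        Finsupp.mapRange.linearMap (α := ι) ((LinearMap.ker q).subtype.rTensor B) ∘ₗ
        (TensorProduct.finsuppLeft A A (LinearMap.ker q) B ι).toLinearMap := by
      ext i k b j
      simp [TensorProduct.finsuppLeft_apply_tmul]
    have hinj : Function.Injective ((TensorProduct.finsuppLeft A A P B ι).toLinearMap ∘ₗ
        (Finsupp.mapRange.linearMap (α := ι) (LinearMap.ker q).subtype).rTensor B) := by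
      rw [hsq]
      exact (Finsupp.mapRange_injective _ (map_zero _) (h _ q hq)).comp
        (LinearEquiv.injective _)
    rw [LinearMap.coe_comp] at hinj
    exact hinj.of_comp

end TorOneZero

section Torsion

variable {A : Type u} [CommRing A] {B : Type u}

theorem torOneZero_of_exact_lTensor [AddCommGroup B] [Module A B]
    {P₂ P₁ P₀ N : Type u} [AddCommGroup P₂] [Module A P₂] [AddCommGroup P₁]
    [Module A P₁] [AddCommGroup P₀] [Module A P₀] [AddCommGroup N] [Module A N]
    [Module.Projective A P₀] {d₂ : P₂ →ₗ[A] P₁} {d₁ : P₁ →ₗ[A] P₀} {p : P₀ →ₗ[A] N}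
    (h₂ : Function.Exact d₂ d₁) (h₁ : Function.Exact d₁ p) (hp : Function.Surjective p)
    (h : Function.Exact (d₂.lTensor B) (d₁.lTensor B)) : TorOneZero (A := A) B N := by
  have hr : LinearMap.range d₁ = LinearMap.ker p := (LinearMap.exact_iff.mp h₁).symm
  refine torOneZero_of_projective (j := (LinearMap.range d₁).subtype) ?_ hp ?_
  · rw [hr]
    exact LinearMap.exact_subtype_ker_map _
  · rw [← LinearMap.lTensor_inj_iff_rTensor_inj, injective_iff_map_eq_zero]
    intro z hz
    obtain ⟨y, rfl⟩ := LinearMap.lTensor_surjective B d₁.surjective_rangeRestrict z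
    rw [← LinearMap.lTensor_comp_apply] at hz
    obtain ⟨x, rfl⟩ := (h y).mp hz
    rw [← LinearMap.lTensor_comp_apply]
    have : d₁.rangeRestrict ∘ₗ d₂ = 0 := by
      ext x
      exact h₂.apply_apply_eq_zero x
    rw [this, LinearMap.lTensor_zero, LinearMap.zero_apply]

theorem torOneZero_of_torVanish [AddCommGroup B] [Module A B] {N : Type u} [AddCommGroup N]
    [Module A N] (h : TorVanish A B N) : TorOneZero (A := A) B N := by
  let P := projectiveResolution (ModuleCat.of A N)
  let F := (MonoidalCategory.tensoringLeft (ModuleCat.{u} A)).obj (ModuleCat.of A B)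
  have hsub := h 1 le_rfl
  have hz : Limits.IsZero ((F.leftDerived 1).obj (ModuleCat.of A N)) :=
    @ModuleCat.isZero_of_subsingleton _ _ _ hsub
  have hex := (HomologicalComplex.exactAt_iff_isZero_homology _ 1).mpr
    (hz.of_iso (P.isoLeftDerivedObj F 1).symm)
  rw [HomologicalComplex.exactAt_iff' _ 2 1 0 (by simp) (by simp),
    ShortComplex.ShortExact.moduleCat_exact_iff_function_exact] at hex
  have h2 := P.exact_succ 0
  have h1 := P.exact₀
  rw [ShortComplex.ShortExact.moduleCat_exact_iff_function_exact] at h1 h2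
  have hp : Function.Surjective (P.π.f 0).hom := by
    rw [← ModuleCat.epi_iff_surjective]; infer_instance
  exact torOneZero_of_exact_lTensor (d₂ := (P.complex.d 2 1).hom) h2 h1 hp hex

variable [CommRing B] [Algebra A B] {f : A}

theorem rTensor_injective_of_flat_baseChange {R : Type u} [CommRing R] [Algebra A R]
    [Module.Flat R (R ⊗[A] B)] {E E' : Type u} [AddCommGroup E] [Module A E] [Module R E]
    [IsScalarTower A R E] [AddCommGroup E'] [Module A E'] [Module R E'] [IsScalarTower A R E']
    (φ : E →ₗ[R] E') (hφ : Function.Injective φ) :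
    Function.Injective ((φ.restrictScalars A).rTensor B) := by
  let e := AlgebraTensorModule.cancelBaseChange A R R E B
  let e' := AlgebraTensorModule.cancelBaseChange A R R E' B
  have hsq : ∀ x, (φ.restrictScalars A).rTensor B (e x) = e' (φ.rTensor (R ⊗[A] B) x) := by
    intro x
    induction x with
    | zero => simp
    | add x y hx hy => simp only [map_add, hx, hy]
    | tmul x y =>
      induction y with
      | zero => simp
      | add y z hy hz => simp only [TensorProduct.tmul_add, map_add, hy, hz]
      | tmul r b => simp [e, e']
  have := Module.Flat.rTensor_preserves_injective_linearMap (M := R ⊗[A] B) φ hφ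
  intro x y hxy
  obtain ⟨x, rfl⟩ := e.surjective x
  obtain ⟨y, rfl⟩ := e.surjective y
  rw [hsq, hsq] at hxy
  rw [this (e'.injective hxy)]

theorem torOneZero_of_flat_baseChange {R : Type u} [CommRing R] [Algebra A R]
    [Module.Flat R (R ⊗[A] B)] (hR : TorOneZero (A := A) B R)
    (N : Type u) [AddCommGroup N] [Module A N] [Module R N] [IsScalarTower A R N] :
    TorOneZero (A := A) B N := by
  obtain ⟨F, _, _, _, _, hF, p, hp⟩ : ∃ (F : Type u) (_ : AddCommGroup F) (_ : Module A F)
      (_ : Module R F) (_ : IsScalarTower A R F) (_ : TorOneZero (A := A) B F) (p : F →ₗ[R] N),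
      Function.Surjective p :=
    ⟨N →₀ R, inferInstance, inferInstance, inferInstance, inferInstance, hR.finsupp N,
      Finsupp.linearCombination R id, Finsupp.linearCombination_id_surjective R N⟩
  have hinj := rTensor_injective_of_flat_baseChange (A := A) (B := B) (LinearMap.ker p).subtype
    Subtype.val_injective
  exact TorOneZero.of_injective_of_exact (p := p.restrictScalars A)
    (i := (LinearMap.ker p).subtype.restrictScalars A)
    (LinearMap.exact_subtype_ker_map p) hp hF Subtype.val_injective hinj

theorem torOneZero_of_smul_eq_zero [Module.Flat (A ⧸ Ideal.span {f}) ((A ⧸ Ideal.span {f}) ⊗[A] B)]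
    (hR : TorOneZero (A := A) B (A ⧸ Ideal.span {f}))
    (N : Type u) [AddCommGroup N] [Module A N] (hN : ∀ x : N, f • x = 0) :
    TorOneZero (A := A) B N := by
  have ht : Module.IsTorsionBySet A N (Ideal.span {f}) :=
    (Module.isTorsionBySet_span_singleton_iff f).mpr fun x => hN x
  let := ht.module
  have : IsScalarTower A (A ⧸ Ideal.span {f}) N := ht.isScalarTower
  exact torOneZero_of_flat_baseChange hR N

theorem torOneZero_of_pow_smul_eq_zero
    [Module.Flat (A ⧸ Ideal.span {f}) ((A ⧸ Ideal.span {f}) ⊗[A] B)]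
    (hR : TorOneZero (A := A) B (A ⧸ Ideal.span {f})) (n : ℕ)
    (N : Type u) [AddCommGroup N] [Module A N] (hN : ∀ x : N, f ^ n • x = 0) :
    TorOneZero (A := A) B N := by
  induction n generalizing N with
  | zero => exact torOneZero_of_smul_eq_zero hR N fun x => by simpa using congrArg (f • ·) (hN x)
  | succ n ih =>
    let K : Submodule A N := LinearMap.ker (LinearMap.lsmul A N f)
    refine TorOneZero.of_exact (i := K.subtype) (p := K.mkQ) Subtype.val_injective
      (LinearMap.exact_subtype_mkQ K) K.mkQ_surjective
      (torOneZero_of_smul_eq_zero hR _ fun x => Subtype.ext x.2) (ih _ fun x => ?_)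
    obtain ⟨x, rfl⟩ := K.mkQ_surjective x
    rw [← map_smul, Submodule.mkQ_apply, Submodule.Quotient.mk_eq_zero]
    change f • f ^ n • x = 0
    rw [smul_smul, ← pow_succ', hN]

theorem rTensor_subtype_injective_of_pow_smul_eq_zero
    [Module.Flat (A ⧸ Ideal.span {f}) ((A ⧸ Ideal.span {f}) ⊗[A] B)]
    (hR : TorOneZero (A := A) B (A ⧸ Ideal.span {f})) {n : ℕ}
    {N : Type u} [AddCommGroup N] [Module A N] (hN : ∀ x : N, f ^ n • x = 0)
    (K : Submodule A N) : Function.Injective (K.subtype.rTensor B) := by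
  refine (torOneZero_of_pow_smul_eq_zero hR n (N ⧸ K) fun x => ?_).injective_of_exact
    Subtype.val_injective (LinearMap.exact_subtype_mkQ K) K.mkQ_surjective
  obtain ⟨x, rfl⟩ := K.mkQ_surjective x
  rw [← map_smul, hN, map_zero]

theorem subsingleton_of_subsingleton_tensorProduct
    [Module.FaithfullyFlat (A ⧸ Ideal.span {f}) ((A ⧸ Ideal.span {f}) ⊗[A] B)] {n : ℕ}
    {N : Type u} [AddCommGroup N] [Module A N] (hN : ∀ x : N, f ^ n • x = 0)
    [Subsingleton (N ⊗[A] B)] : Subsingleton N := by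
  let R := A ⧸ Ideal.span {f}
  let K : Submodule A N := LinearMap.range (LinearMap.lsmul A N f)
  have ht : Module.IsTorsionBySet A (N ⧸ K) (Ideal.span {f}) :=
    (Module.isTorsionBySet_span_singleton_iff f).mpr fun x => by
      obtain ⟨x, rfl⟩ := K.mkQ_surjective x
      rw [← map_smul, Submodule.mkQ_apply, Submodule.Quotient.mk_eq_zero]
      exact ⟨x, rfl⟩
  let := ht.module
  have : IsScalarTower A R (N ⧸ K) := ht.isScalarTower
  have : Subsingleton ((N ⧸ K) ⊗[A] B) :=
    (LinearMap.rTensor_surjective B K.mkQ_surjective).subsingleton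
  have : Subsingleton ((N ⧸ K) ⊗[R] (R ⊗[A] B)) :=
    (AlgebraTensorModule.cancelBaseChange A R R (N ⧸ K) B).toEquiv.subsingleton
  have hK : Subsingleton (N ⧸ K) :=
    Module.FaithfullyFlat.rTensor_reflects_triviality R (R ⊗[A] B) (N ⧸ K)
  have hdiv : ∀ x : N, ∃ y, f • y = x := fun x => by
    have : x ∈ K := by rw [Submodule.Quotient.subsingleton_iff.mp hK]; trivial
    exact this
  have hdivn : ∀ (m : ℕ) (x : N), ∃ y, f ^ m • y = x := by
    intro m
    induction m with
    | zero => exact fun x => ⟨x, by simp⟩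
    | succ m ih =>
      intro x
      obtain ⟨y, rfl⟩ := ih x
      obtain ⟨z, rfl⟩ := hdiv y
      exact ⟨z, by rw [pow_succ, mul_smul]⟩
  refine subsingleton_of_forall_eq 0 fun x => ?_
  obtain ⟨y, rfl⟩ := hdivn n x
  exact hN y

theorem exact_of_exact_rTensor
    [Module.FaithfullyFlat (A ⧸ Ideal.span {f}) ((A ⧸ Ideal.span {f}) ⊗[A] B)]
    (hR : TorOneZero (A := A) B (A ⧸ Ideal.span {f})) {n : ℕ}
    {E₁ E₂ E₃ : Type u} [AddCommGroup E₁] [Module A E₁] [AddCommGroup E₂] [Module A E₂]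
    [AddCommGroup E₃] [Module A E₃] (hE : ∀ x : E₂, f ^ n • x = 0)
    {u : E₁ →ₗ[A] E₂} {v : E₂ →ₗ[A] E₃} (hvu : v ∘ₗ u = 0)
    (h : ∀ z, v.rTensor B z = 0 → ∃ y, u.rTensor B y = z) : Function.Exact u v := by
  let K := LinearMap.ker v
  let u' : E₁ →ₗ[A] K := u.codRestrict K fun x => LinearMap.congr_fun hvu x
  have hKu : K.subtype ∘ₗ u' = u := rfl
  have hsurj : Function.Surjective (u'.rTensor B) := by
    intro k
    obtain ⟨y, hy⟩ := h (K.subtype.rTensor B k) (by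
      rw [← LinearMap.rTensor_comp_apply, LinearMap.comp_ker_subtype, LinearMap.rTensor_zero,
        LinearMap.zero_apply])
    refine ⟨y, rTensor_subtype_injective_of_pow_smul_eq_zero hR hE K ?_⟩
    rw [← LinearMap.rTensor_comp_apply, hKu, hy]
  let L := LinearMap.range u'
  have hex := rTensor_exact B (LinearMap.exact_map_mkQ_range u') L.mkQ_surjective
  have : Subsingleton ((K ⧸ L) ⊗[A] B) := by
    refine subsingleton_of_forall_eq 0 fun x => ?_
    obtain ⟨x, rfl⟩ := LinearMap.rTensor_surjective B L.mkQ_surjective x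
    exact (hex x).mpr (hsurj x)
  have hKL : Subsingleton (K ⧸ L) := by
    refine subsingleton_of_subsingleton_tensorProduct (B := B) (f := f) (n := n) fun x => ?_
    obtain ⟨x, rfl⟩ := L.mkQ_surjective x
    rw [← map_smul, show f ^ n • x = 0 from Subtype.ext (hE x), map_zero]
  intro x
  refine ⟨fun hx => ?_, by rintro ⟨y, rfl⟩; exact LinearMap.congr_fun hvu y⟩
  have : (⟨x, hx⟩ : K) ∈ L := by
    rw [Submodule.Quotient.subsingleton_iff.mp hKL]; trivial
  obtain ⟨y, hy⟩ := this
  exact ⟨y, congrArg Subtype.val hy⟩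

end Torsion

section Amitsur

variable {A : Type u} [CommRing A] (B : Type u) [CommRing B] [Algebra A B]
  (N : Type u) [AddCommGroup N] [Module A N]

/-- The differential `N ⊗ B^{⊗m} → N ⊗ B^{⊗(m+1)}` of the augmented Amitsur complex of `A → B`
with coefficients in `N`. -/
noncomputable def amitsurDiff (m : ℕ) :
    N ⊗[A] (Bpow A B m).carrier →ₗ[A] N ⊗[A] (Bpow A B (m + 1)).carrier :=
  ∑ i : Fin (m + 1), ((-1 : A) ^ (i : ℕ)) • (faceMap A B m i).toLinearMap.lTensor N

/-- Splitting off the last tensor factor of `N ⊗ B^{⊗(m+1)}`. -/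
noncomputable def amitsurAssoc (m : ℕ) :
    N ⊗[A] (Bpow A B (m + 1)).carrier ≃ₗ[A] (N ⊗[A] (Bpow A B m).carrier) ⊗[A] B :=
  (TensorProduct.assoc A N (Bpow A B m).carrier B).symm

/-- Multiplying the last two tensor factors of `N ⊗ B^{⊗(m+1)} ⊗ B`. -/
noncomputable def amitsurMul (m : ℕ) :
    (N ⊗[A] (Bpow A B (m + 1)).carrier) ⊗[A] B →ₗ[A] (N ⊗[A] (Bpow A B m).carrier) ⊗[A] B :=
  (LinearMap.mul' A B).lTensor _ ∘ₗ
    (TensorProduct.assoc A (N ⊗[A] (Bpow A B m).carrier) B B).toLinearMap ∘ₗ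
    (amitsurAssoc B N m).toLinearMap.rTensor B

variable {B N}

theorem faceMap_castSucc (m : ℕ) (i : Fin (m + 1)) :
    faceMap A B (m + 1) i.castSucc =
      Algebra.TensorProduct.map (faceMap A B m i) (AlgHom.id A B) :=
  Fin.lastCases_castSucc ..

theorem faceMap_last (m : ℕ) :
    faceMap A B (m + 1) (Fin.last (m + 1)) = Algebra.TensorProduct.includeLeft :=
  Fin.lastCases_last ..

theorem amitsurAssoc_induction {m : ℕ} {p : N ⊗[A] (Bpow A B (m + 1)).carrier → Prop}
    (x : N ⊗[A] (Bpow A B (m + 1)).carrier) (zero : p 0) (add : ∀ x y, p x → p y → p (x + y))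
    (tmul : ∀ y b, p ((amitsurAssoc B N m).symm (y ⊗ₜ b))) : p x := by
  obtain ⟨x, rfl⟩ := (amitsurAssoc B N m).symm.surjective x
  induction x with
  | zero => simpa using zero
  | add y z hy hz => simpa using add _ _ hy hz
  | tmul y b => exact tmul y b

@[simp]
theorem amitsurMul_tmul (m : ℕ) (y : N ⊗[A] (Bpow A B m).carrier) (b c : B) :
    amitsurMul (A := A) B N m ((amitsurAssoc B N m).symm (y ⊗ₜ b) ⊗ₜ c) = y ⊗ₜ (b * c) := by
  simp [amitsurMul]

theorem amitsurDiff_zero (x : N ⊗[A] (Bpow A B 0).carrier) :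
    amitsurDiff (A := A) B N 0 x = (amitsurAssoc B N 0).symm (x ⊗ₜ 1) := by
  induction x with
  | zero => simp
  | add y z hy hz => simp only [TensorProduct.add_tmul, map_add, hy, hz]
  | tmul x a =>
    simp only [amitsurDiff, Fin.sum_univ_succ]
    simp
    rfl

theorem amitsurDiff_succ (m : ℕ) (y : N ⊗[A] (Bpow A B m).carrier) (b : B) :
    amitsurDiff (A := A) B N (m + 1) ((amitsurAssoc B N m).symm (y ⊗ₜ b)) =
      (amitsurAssoc B N (m + 1)).symm (amitsurDiff (A := A) B N m y ⊗ₜ b) +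
      (-1 : A) ^ (m + 1) •
        (amitsurAssoc B N (m + 1)).symm ((amitsurAssoc B N m).symm (y ⊗ₜ b) ⊗ₜ 1) := by
  induction y with
  | zero => simp
  | add y z hy hz =>
    simp only [TensorProduct.add_tmul, map_add, hy, hz, smul_add]; abel
  | tmul x c =>
    simp only [amitsurDiff, Fin.sum_univ_castSucc (n := m + 1), LinearMap.add_apply,
      LinearMap.sum_apply, LinearMap.smul_apply, TensorProduct.sum_tmul, map_sum]
    congr 1
    · refine Finset.sum_congr rfl fun i _ => ?_
      rw [faceMap_castSucc, ← TensorProduct.smul_tmul', map_smul]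
      rfl
    · rw [faceMap_last]
      rfl

theorem amitsurDiff_comp (m : ℕ) :
    amitsurDiff (A := A) B N (m + 1) ∘ₗ amitsurDiff (A := A) B N m = 0 := by
  induction m with
  | zero =>
    refine LinearMap.ext fun x => ?_
    simp [amitsurDiff_zero, amitsurDiff_succ]
  | succ m ih =>
    refine LinearMap.ext fun x => ?_
    induction x using amitsurAssoc_induction with
    | zero => simp
    | add x y hx hy => rw [map_add, hx, hy, map_add]
    | tmul y b =>
      have h0 : amitsurDiff (A := A) B N (m + 1) (amitsurDiff (A := A) B N m y) = 0 :=
        LinearMap.congr_fun ih y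
      simp only [LinearMap.comp_apply, amitsurDiff_succ, map_add, map_smul, h0,
        TensorProduct.add_tmul, smul_add, TensorProduct.zero_tmul, map_zero,
        ← TensorProduct.smul_tmul', pow_succ (-1 : A) (m + 1)]
      simp [smul_smul, ← mul_pow]

theorem amitsurMul_zero_diff (z : (N ⊗[A] (Bpow A B 0).carrier) ⊗[A] B) :
    amitsurMul (A := A) B N 0 ((amitsurDiff (A := A) B N 0).rTensor B z) = z := by
  induction z with
  | zero => simp
  | add y z hy hz => simp only [map_add, hy, hz]
  | tmul y b => simp [amitsurDiff_zero]

theorem amitsurMul_succ_diff (m : ℕ) (z : (N ⊗[A] (Bpow A B (m + 1)).carrier) ⊗[A] B) :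
    amitsurMul (A := A) B N (m + 1) ((amitsurDiff (A := A) B N (m + 1)).rTensor B z) =
      (amitsurDiff (A := A) B N m).rTensor B (amitsurMul (A := A) B N m z) +
        (-1 : A) ^ (m + 1) • z := by
  induction z with
  | zero => simp
  | add y z hy hz => simp only [map_add, hy, hz, smul_add]; abel
  | tmul y c =>
    induction y using amitsurAssoc_induction with
    | zero => simp
    | add x y hx hy => simp only [TensorProduct.add_tmul, map_add, hx, hy, smul_add]; abel
    | tmul y b =>
      simp [amitsurDiff_succ, TensorProduct.add_tmul, ← TensorProduct.smul_tmul']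

variable {f : A} [Module.FaithfullyFlat (A ⧸ Ideal.span {f}) ((A ⧸ Ideal.span {f}) ⊗[A] B)]

theorem amitsurDiff_exact (hR : TorOneZero (A := A) B (A ⧸ Ideal.span {f})) {n : ℕ}
    (hN : ∀ x : N, f ^ n • x = 0) (m : ℕ) :
    Function.Exact (amitsurDiff (A := A) B N m) (amitsurDiff (A := A) B N (m + 1)) := by
  refine exact_of_exact_rTensor (B := B) (f := f) (n := n) hR (fun x => ?_)
    (amitsurDiff_comp m) fun z hz => ⟨(-1 : A) ^ m • amitsurMul (A := A) B N m z, ?_⟩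
  · induction x with
    | zero => simp
    | add x y hx hy => rw [smul_add, hx, hy, add_zero]
    | tmul x c => rw [TensorProduct.smul_tmul', hN, TensorProduct.zero_tmul]
  · have h := amitsurMul_succ_diff m z
    rw [hz, map_zero, eq_comm, add_eq_zero_iff_eq_neg] at h
    rw [map_smul, h, pow_succ]
    simp [smul_smul, ← mul_pow]

theorem amitsurDiff_zero_injective (hR : TorOneZero (A := A) B (A ⧸ Ideal.span {f})) {n : ℕ}
    (hN : ∀ x : N, f ^ n • x = 0) : Function.Injective (amitsurDiff (A := A) B N 0) := by
  have h : Function.Exact (0 : PUnit.{u + 1} →ₗ[A] _) (amitsurDiff (A := A) B N 0) := by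
    refine exact_of_exact_rTensor (B := B) (f := f) (n := n) hR (fun x => ?_)
      (LinearMap.comp_zero _) fun z hz => ⟨0, ?_⟩
    · induction x with
      | zero => simp
      | add x y hx hy => rw [smul_add, hx, hy, add_zero]
      | tmul x c => rw [TensorProduct.smul_tmul', hN, TensorProduct.zero_tmul]
    · rw [← amitsurMul_zero_diff z, hz, map_zero, map_zero]
  rw [injective_iff_map_eq_zero]
  intro x hx
  obtain ⟨y, rfl⟩ := (h x).mp hx
  rfl

end Amitsur

section Completion

variable {A : Type u} [CommRing A]

/-- If a complex is exact modulo `I ^ n` in two consecutive spots for every `n`, then its completion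
is exact in the second one. -/
theorem AdicCompletion.map_exact_of_exact_mod_pow (I : Ideal A) {W X Y Z : Type*}
    [AddCommGroup W] [Module A W] [AddCommGroup X] [Module A X]
    [AddCommGroup Y] [Module A Y] [AddCommGroup Z] [Module A Z]
    {c : W →ₗ[A] X} {d : X →ₗ[A] Y} {e : Y →ₗ[A] Z}
    (hdc : d ∘ₗ c = 0) (hed : e ∘ₗ d = 0)
    (hd : ∀ n x, d x ∈ (I ^ n • ⊤ : Submodule A Y) → ∃ w, x - c w ∈ (I ^ n • ⊤ : Submodule A X))
    (he : ∀ n y, e y ∈ (I ^ n • ⊤ : Submodule A Z) → ∃ x, y - d x ∈ (I ^ n • ⊤ : Submodule A Y)) :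
    Function.Exact (AdicCompletion.map I d) (AdicCompletion.map I e) := by
  intro y
  constructor
  · induction y using AdicCompletion.induction_on with | _ y => ?_
    intro hy
    have hey (n : ℕ) : e (y n) ∈ (I ^ n • ⊤ : Submodule A Z) :=
      (Submodule.Quotient.mk_eq_zero _).mp (congrArg (fun z => z.val n) hy)
    have step (n : ℕ) (x : {x : X // y n - d x ∈ (I ^ n • ⊤ : Submodule A Y)}) :
        ∃ x' : {x : X // y (n + 1) - d x ∈ (I ^ (n + 1) • ⊤ : Submodule A Y)},
          x.1 - x'.1 ∈ (I ^ n • ⊤ : Submodule A X) := by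
      obtain ⟨x, hx⟩ := x
      obtain ⟨x', hx'⟩ := he (n + 1) (y (n + 1)) (hey _)
      have hle : (I ^ (n + 1) • ⊤ : Submodule A Y) ≤ I ^ n • ⊤ :=
        Submodule.smul_mono_left (Ideal.pow_le_pow_right n.le_succ)
      have hyn : y n - y (n + 1) ∈ (I ^ n • ⊤ : Submodule A Y) :=
        (Submodule.Quotient.eq _).mp (y.2 n.le_succ)
      obtain ⟨w, hw⟩ := hd n (x - x') (by
        have := Submodule.add_mem _ (Submodule.sub_mem _ hyn hx) (hle hx')
        rw [map_sub]
        convert this using 1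
        abel)
      refine ⟨⟨x' + c w, ?_⟩, by rwa [← sub_sub]⟩
      have hdcw : d (c w) = 0 := LinearMap.congr_fun hdc w
      rwa [map_add, hdcw, add_zero]
    choose lift hlift using step
    let s (n : ℕ) : {x : X // y n - d x ∈ (I ^ n • ⊤ : Submodule A Y)} :=
      Nat.rec ⟨0, by simp⟩ lift n
    refine ⟨AdicCompletion.mk I X (AdicCompletion.AdicCauchySequence.mk I X (fun n => (s n).1)
      fun n => (Submodule.Quotient.eq _).mpr (hlift n (s n))), ?_⟩
    refine AdicCompletion.ext fun n => ?_
    exact ((Submodule.Quotient.eq _).mpr (s n).2).symm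
  · rintro ⟨x, rfl⟩
    rw [AdicCompletion.map_comp_apply, hed, AdicCompletion.map_zero, LinearMap.zero_apply]

theorem rTensor_mkQ_eq_zero_iff {M C : Type*} [AddCommGroup M] [Module A M]
    [AddCommGroup C] [Module A C] (J : Ideal A) (z : M ⊗[A] C) :
    (J • ⊤ : Submodule A M).mkQ.rTensor C z = 0 ↔ z ∈ (J • ⊤ : Submodule A (M ⊗[A] C)) := by
  constructor
  · intro hz
    obtain ⟨w, rfl⟩ := (rTensor_exact C (LinearMap.exact_subtype_mkQ (J • ⊤ : Submodule A M))
      (Submodule.mkQ_surjective _) z).mp hz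
    clear hz
    induction w with
    | zero => simp
    | add x y hx hy => rw [map_add]; exact Submodule.add_mem _ hx hy
    | tmul m c =>
      have h : ((J • ⊤ : Submodule A M).map ((TensorProduct.mk A M C).flip c)) ≤ J • ⊤ := by
        rw [Submodule.map_smul'']
        exact smul_mono_right _ le_top
      exact h ⟨m.1, m.2, rfl⟩
  · intro hz
    induction hz using Submodule.smul_induction_on' with
    | add x _ y _ hx hy => rw [map_add, hx, hy, add_zero]
    | smul r hr z _ =>
      rw [map_smul]
      induction z with
      | zero => simp
      | add x y hx hy => rw [map_add, smul_add, hx trivial, hy trivial, add_zero]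
      | tmul m c =>
        rw [LinearMap.rTensor_tmul, TensorProduct.smul_tmul', ← map_smul,
          (Submodule.mkQ_apply _ _).trans ((Submodule.Quotient.mk_eq_zero _).mpr
            (Submodule.smul_mem_smul hr Submodule.mem_top)), TensorProduct.zero_tmul]

variable {B : Type u} [CommRing B] [Algebra A B] {M : Type u} [AddCommGroup M] [Module A M]

theorem rTensor_amitsurDiff {N : Type u} [AddCommGroup N] [Module A N] (g : M →ₗ[A] N) (m : ℕ)
    (x : M ⊗[A] (Bpow A B m).carrier) :
    g.rTensor _ (amitsurDiff B M m x) = amitsurDiff B N m (g.rTensor _ x) := by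
  simp only [amitsurDiff, LinearMap.sum_apply, map_sum, LinearMap.smul_apply, map_smul]
  refine Finset.sum_congr rfl fun i _ => ?_
  rw [← LinearMap.comp_apply, ← LinearMap.comp_apply, LinearMap.rTensor_comp_lTensor,
    LinearMap.lTensor_comp_rTensor]

/-- `AdicCompletion.map` as a linear map in the morphism. -/
noncomputable def AdicCompletion.mapLinear (I : Ideal A) (X Y : Type*) [AddCommGroup X] [Module A X]
    [AddCommGroup Y] [Module A Y] :
    (X →ₗ[A] Y) →ₗ[A] AdicCompletion I X →ₗ[A] AdicCompletion I Y where
  toFun φ := (AdicCompletion.map I φ).restrictScalars A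
  map_add' _ _ := AdicCompletion.map_ext'' _ rfl
  map_smul' _ _ := AdicCompletion.map_ext'' _ rfl

variable (A B M) in
theorem amitsurD_eq_map_amitsurDiff (f : A) (m : ℕ) (y : AmitsurTerm A B f M m) :
    amitsurD A B f M m y = AdicCompletion.map (Ideal.span {f}) (amitsurDiff B M (m + 1)) y := by
  have h : amitsurD A B f M m =
      AdicCompletion.mapLinear (Ideal.span {f}) _ _ (amitsurDiff B M (m + 1)) := by
    rw [amitsurDiff, map_sum]
    refine Finset.sum_congr rfl fun i _ => ?_
    rw [map_smul, ← Int.cast_smul_eq_zsmul A]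
    push_cast
    rfl
  exact LinearMap.congr_fun h y

variable (A B M) in
theorem amitsurD_zero_apply (f : A) (y : AmitsurTerm A B f M 0) :
    amitsurD A B f M 0 y =
      (AdicCompletion.map (Ideal.span {f})
        ((faceMap A B 1 0).toLinearMap.lTensor M) y : AmitsurTerm A B f M 1) -
      (AdicCompletion.map (Ideal.span {f})
        ((faceMap A B 1 1).toLinearMap.lTensor M) y : AmitsurTerm A B f M 1) := by
  have h : amitsurD A B f M 0 =
      AdicCompletion.mapLinear (Ideal.span {f}) _ _ ((faceMap A B 1 0).toLinearMap.lTensor M) -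
      AdicCompletion.mapLinear (Ideal.span {f}) _ _ ((faceMap A B 1 1).toLinearMap.lTensor M) := by
    refine (Fin.sum_univ_two _).trans ?_
    simp only [Fin.val_zero, pow_zero, one_smul, Fin.val_one, pow_one, neg_smul, sub_eq_add_neg]
    rfl
  exact LinearMap.congr_fun h y

theorem exists_amitsurAug_eq {f : A} [IsAdicComplete (Ideal.span {f}) M] :
    ∃ e : M ≃ AdicCompletion (Ideal.span {f}) (M ⊗[A] (Bpow A B 0).carrier),
      ∀ x, amitsurAug A B f M x =
        AdicCompletion.map (Ideal.span {f}) (amitsurDiff B M 0) (e x) := by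
  let e : M ≃ₗ[A] M ⊗[A] (Bpow A B 0).carrier := (TensorProduct.rid A M).symm
  refine ⟨(AdicCompletion.ofLinearEquiv (Ideal.span {f}) M).toEquiv.trans
    (AdicCompletion.congr (Ideal.span {f}) e).toEquiv, fun x => ?_⟩
  change AdicCompletion.of _ _ (x ⊗ₜ 1) = AdicCompletion.map _ _
    (AdicCompletion.map _ e.toLinearMap (AdicCompletion.of _ _ x))
  rw [AdicCompletion.map_of, AdicCompletion.map_of, amitsurDiff_zero]
  rfl

variable {f : A} [Module.FaithfullyFlat (A ⧸ Ideal.span {f}) ((A ⧸ Ideal.span {f}) ⊗[A] B)]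

theorem pow_smul_quotient_span_pow_smul_top (n : ℕ)
    (x : M ⧸ (Ideal.span {f} ^ n • ⊤ : Submodule A M)) : f ^ n • x = 0 := by
  induction x using Submodule.Quotient.induction_on with | _ x => ?_
  exact (Submodule.Quotient.mk_eq_zero _).mpr (Submodule.smul_mem_smul
    (Ideal.pow_mem_pow (Ideal.mem_span_singleton_self f) n) trivial)

theorem amitsurDiff_exact_mod_pow (hR : TorOneZero (A := A) B (A ⧸ Ideal.span {f})) (n m : ℕ)
    (y : M ⊗[A] (Bpow A B (m + 1)).carrier)
    (hy : amitsurDiff B M (m + 1) y ∈ (Ideal.span {f} ^ n • ⊤ : Submodule A _)) :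
    ∃ x, y - amitsurDiff B M m x ∈ (Ideal.span {f} ^ n • ⊤ : Submodule A _) := by
  rw [← rTensor_mkQ_eq_zero_iff, rTensor_amitsurDiff] at hy
  obtain ⟨x, hx⟩ := (amitsurDiff_exact hR (pow_smul_quotient_span_pow_smul_top n) m _).mp hy
  obtain ⟨x, rfl⟩ := LinearMap.rTensor_surjective _ (Submodule.mkQ_surjective _) x
  exact ⟨x, by rw [← rTensor_mkQ_eq_zero_iff, map_sub, rTensor_amitsurDiff, hx, sub_self]⟩

theorem amitsurDiff_zero_injective_mod_pow (hR : TorOneZero (A := A) B (A ⧸ Ideal.span {f}))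
    (n : ℕ) (x : M ⊗[A] (Bpow A B 0).carrier)
    (hx : amitsurDiff B M 0 x ∈ (Ideal.span {f} ^ n • ⊤ : Submodule A _)) :
    x ∈ (Ideal.span {f} ^ n • ⊤ : Submodule A _) := by
  rw [← rTensor_mkQ_eq_zero_iff, rTensor_amitsurDiff] at hx
  rw [← rTensor_mkQ_eq_zero_iff]
  exact (injective_iff_map_eq_zero _).mp
    (amitsurDiff_zero_injective hR (pow_smul_quotient_span_pow_smul_top n)) _ hx

theorem map_amitsurDiff_exact (hR : TorOneZero (A := A) B (A ⧸ Ideal.span {f})) (m : ℕ) :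
    Function.Exact (AdicCompletion.map (Ideal.span {f}) (amitsurDiff B M m))
      (AdicCompletion.map (Ideal.span {f}) (amitsurDiff B M (m + 1))) := by
  cases m with
  | zero =>
    refine AdicCompletion.map_exact_of_exact_mod_pow (c := (0 : PUnit →ₗ[A] _)) _
      (LinearMap.comp_zero _) (amitsurDiff_comp 0) (fun n x hx => ⟨0, ?_⟩)
      fun n => amitsurDiff_exact_mod_pow hR n 0
    rw [map_zero, sub_zero]
    exact amitsurDiff_zero_injective_mod_pow hR n x hx
  | succ m =>
    exact AdicCompletion.map_exact_of_exact_mod_pow _ (amitsurDiff_comp m)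
      (amitsurDiff_comp (m + 1)) (fun n => amitsurDiff_exact_mod_pow hR n m)
      fun n => amitsurDiff_exact_mod_pow hR n (m + 1)

theorem map_amitsurDiff_zero_injective (hR : TorOneZero (A := A) B (A ⧸ Ideal.span {f})) :
    Function.Injective (AdicCompletion.map (Ideal.span {f}) (amitsurDiff B M 0)) := by
  rw [injective_iff_map_eq_zero]
  intro x
  induction x using AdicCompletion.induction_on with | _ x => ?_
  intro hx
  refine AdicCompletion.ext fun n => (Submodule.Quotient.mk_eq_zero _).mpr ?_
  exact amitsurDiff_zero_injective_mod_pow hR n _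
    ((Submodule.Quotient.mk_eq_zero _).mp (congrArg (fun z => z.val n) hx))

end Completion

/-- Let `(A,(f))` be of reduced prismatic type, `B` a derived `f`-complete
`(f)`-completely faithfully flat `A`-algebra, and `M` an `f`-adically complete `A`-module
with `M/f^nM` flat over `A/f^nA` for all `n ≥ 1`. Then the augmented completed Amitsur
complex `0 → M → M ⊗̂_A B → M ⊗̂_A B^{⊗2} → ⋯` is exact. In particular, `M` is the equalizer
of the two natural maps `M ⊗̂_A B ⇉ M ⊗̂_A (B ⊗_A B)`. -/
theorem completed_amitsur_complex_exact
    (hder : DerivedComplete A f A)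
    (hbdd : ∃ c : ℕ, ∀ x : A, (∃ n : ℕ, f ^ n * x = 0) → f ^ c * x = 0)
    (hBder : DerivedComplete A f B)
    (hBTor : TorVanish A B (A ⧸ Ideal.span {f}))
    (hBff : Module.FaithfullyFlat (A ⧸ Ideal.span {f}) ((A ⧸ Ideal.span {f}) ⊗[A] B))
    (hMc : IsAdicComplete (Ideal.span {f}) M)
    (hMflat : ∀ n : ℕ, 1 ≤ n →
      Module.Flat (A ⧸ (Ideal.span {f} ^ n)) ((A ⧸ (Ideal.span {f} ^ n)) ⊗[A] M)) :
    Function.Injective (amitsurAug A B f M) ∧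
    Function.Exact (amitsurAug A B f M) (amitsurD A B f M 0) ∧
    (∀ m : ℕ, Function.Exact (amitsurD A B f M m) (amitsurD A B f M (m + 1))) ∧
    -- in particular, `M` is the equalizer of the two maps `M ⊗̂ B ⇉ M ⊗̂ (B ⊗ B)`
    (∀ y : AmitsurTerm A B f M 0,
      (AdicCompletion.map (Ideal.span {f})
          (LinearMap.lTensor M (faceMap A B 1 0).toLinearMap) y =
        AdicCompletion.map (Ideal.span {f})
          (LinearMap.lTensor M (faceMap A B 1 1).toLinearMap) y) ↔
      ∃ x : M, amitsurAug A B f M x = y) := by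
  have hR := torOneZero_of_torVanish hBTor
  obtain ⟨e, he⟩ := exists_amitsurAug_eq (B := B) (f := f) (M := M)
  have hexact : Function.Exact (amitsurAug A B f M) (amitsurD A B f M 0) := by
    intro y
    rw [amitsurD_eq_map_amitsurDiff]
    refine (map_amitsurDiff_exact hR 0 y).trans ⟨?_, ?_⟩
    · rintro ⟨x, rfl⟩
      exact ⟨e.symm x, by rw [he, e.apply_symm_apply]⟩
    · rintro ⟨x, rfl⟩
      exact ⟨e x, (he x).symm⟩
  refine ⟨fun x y hxy => ?_, hexact, fun m y => ?_, fun y => ?_⟩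
  · rw [he, he] at hxy
    exact e.injective (map_amitsurDiff_zero_injective hR hxy)
  · rw [amitsurD_eq_map_amitsurDiff]
    refine (map_amitsurDiff_exact hR (m + 1) y).trans (exists_congr fun x => ?_)
    have h := amitsurD_eq_map_amitsurDiff A B M f m x
    exact ⟨h.trans, h.symm.trans⟩
  · refine Iff.trans ?_ (hexact y)
    rw [amitsurD_zero_apply]
    exact sub_eq_zero.symm
end
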